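/- arXiv:0909.3989 — 2 statements merged into one kernel-verified Lean document; each statement's English description precedes it below -/
import Mathlib

section
/- Let p ≥ 5 be prime and let G ≤ Sp_{2p}(ℚ) be an s.p.i.m.f. subgroup. Then the Fitting subgroup of G is cyclic of order 2, 4, or 6; that is, there exists a normal nilpotent subgroup F of G that contains every normal nilpotent subgroup of G, and this F is cyclic with |F| ∈ {2, 4, 6}. -/
open Matrix
open scoped MatrixGroups

/-- `G ≤ GL_{2n}(ℚ)` (rows/columns indexed by `Fin n ⊕ Fin n`) is symplectic if it fixes
some invertible skew-symmetric form. -/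
def IsSymplecticGroup {n : ℕ} (G : Subgroup (GL (Fin n ⊕ Fin n) ℚ)) : Prop :=
  ∃ A : Matrix (Fin n ⊕ Fin n) (Fin n ⊕ Fin n) ℚ, Aᵀ = -A ∧ IsUnit A ∧
    ∀ g ∈ G, (g : Matrix (Fin n ⊕ Fin n) (Fin n ⊕ Fin n) ℚ) * A *
      (g : Matrix (Fin n ⊕ Fin n) (Fin n ⊕ Fin n) ℚ)ᵀ = A

/-- A `ℚ`-subspace of the natural (right) module `ℚ^{1×2n}` invariant under `G`. -/
def IsInvariantSubspace {n : ℕ} (G : Subgroup (GL (Fin n ⊕ Fin n) ℚ))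
    (W : Submodule ℚ (Fin n ⊕ Fin n → ℚ)) : Prop :=
  ∀ g ∈ G, ∀ v ∈ W, v ᵥ* (g : Matrix (Fin n ⊕ Fin n) (Fin n ⊕ Fin n) ℚ) ∈ W

/-- `G` is rationally irreducible. -/
def IsRatIrreducible {n : ℕ} (G : Subgroup (GL (Fin n ⊕ Fin n) ℚ)) : Prop :=
  ∀ W : Submodule ℚ (Fin n ⊕ Fin n → ℚ), IsInvariantSubspace G W → W = ⊥ ∨ W = ⊤

/-- `G ≤ GL_{2n}(ℚ)` is symplectic imprimitive: `G` is conjugate in `GL_{2n}(ℚ)` to a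
subgroup of a wreath product `H ≀ S_k` (`k ≥ 2`, `n = d·k`) where `H ≤ GL_{2d}(ℚ)` is
the (symplectic) stabilizer of an invertible skew-symmetric form `A`, the base group
acting blockwise on `(ℚ^{1×2d})^k` and `S_k` permuting the blocks. -/
def IsSympImprimitive {n : ℕ} (G : Subgroup (GL (Fin n ⊕ Fin n) ℚ)) : Prop :=
  ∃ (d k : ℕ), n = d * k ∧ 2 ≤ k ∧
    ∃ (e : Fin k × Fin (2 * d) ≃ (Fin n ⊕ Fin n))
      (A : Matrix (Fin (2 * d)) (Fin (2 * d)) ℚ) (T : GL (Fin n ⊕ Fin n) ℚ),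
      Aᵀ = -A ∧ IsUnit A ∧
      ∀ g ∈ G, ∃ (σ : Equiv.Perm (Fin k)) (h : Fin k → Matrix (Fin (2 * d)) (Fin (2 * d)) ℚ),
        (∀ i, h i * A * (h i)ᵀ = A) ∧
        ((T * g * T⁻¹ : GL (Fin n ⊕ Fin n) ℚ) : Matrix (Fin n ⊕ Fin n) (Fin n ⊕ Fin n) ℚ) =
          Matrix.reindex e e
            (Matrix.of fun p q : Fin k × Fin (2 * d) =>
              if σ p.1 = q.1 then h p.1 p.2 q.2 else 0)

/-- `G` is s.p.i.m.f.: finite, symplectic, rationally irreducible, symplectic primitive,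
and maximal among finite symplectic subgroups of `GL_{2n}(ℚ)`. -/
def IsSPIMF {n : ℕ} (G : Subgroup (GL (Fin n ⊕ Fin n) ℚ)) : Prop :=
  (G : Set (GL (Fin n ⊕ Fin n) ℚ)).Finite ∧ IsSymplecticGroup G ∧ IsRatIrreducible G ∧
    ¬ IsSympImprimitive G ∧
    ∀ H : Subgroup (GL (Fin n ⊕ Fin n) ℚ), (H : Set (GL (Fin n ⊕ Fin n) ℚ)).Finite →
      IsSymplecticGroup H → G ≤ H → H = G

section LinearAlgebra

open Module

variable {V : Type*} [AddCommGroup V] [Module ℚ V]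

/-- A nondegenerate alternating form lives on an even-dimensional space. -/
theorem even_finrank_of_isAlt_of_nondegenerate [FiniteDimensional ℚ V]
    (ω : LinearMap.BilinForm ℚ V)
    (halt : ∀ v w, ω v w = -ω w v) (hnd : ∀ v, (∀ w, ω v w = 0) → v = 0) :
    Even (finrank ℚ V) := by
  classical
  let b := finBasis ℚ V
  have hdet : (LinearMap.BilinForm.toMatrix b ω).det ≠ 0 := by
    rw [← LinearMap.BilinForm.nondegenerate_iff_det_ne_zero]
    refine ⟨hnd, fun v hv => hnd v fun w => ?_⟩
    rw [halt, hv, neg_zero]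
  have hT : (LinearMap.BilinForm.toMatrix b ω)ᵀ = -LinearMap.BilinForm.toMatrix b ω := by
    ext i j
    simpa [LinearMap.BilinForm.toMatrix_apply] using halt (b j) (b i)
  have h := congrArg Matrix.det hT
  rw [Matrix.det_transpose, Matrix.det_neg, Fintype.card_fin] at h
  by_contra hodd
  rw [Nat.not_even_iff_odd] at hodd
  rw [hodd.neg_one_pow] at h
  apply hdet
  linarith

/-- An isometric involution of a symplectic space of dimension `2 * p`, `p` odd, does not
anticommute with any injective endomorphism. -/
theorem false_of_anticommuting_involution [FiniteDimensional ℚ V] {p : ℕ}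
    (hp : Odd p) (hV : finrank ℚ V = 2 * p)
    (ω : LinearMap.BilinForm ℚ V) (halt : ∀ v w, ω v w = -ω w v)
    (hnd : ∀ v, (∀ w, ω v w = 0) → v = 0) {s d : Module.End ℚ V} (hs : s * s = 1)
    (hiso : ∀ v w, ω (s v) (s w) = ω v w) (hd : Function.Injective d) (hsd : s * d = -(d * s)) :
    False := by
  have hss : ∀ v, s (s v) = v := fun v => by simpa using LinearMap.congr_fun hs v
  have hsd' : ∀ v, s (d v) = -d (s v) := fun v => by simpa using LinearMap.congr_fun hsd v
  let P : Submodule ℚ V := LinearMap.ker (s - 1)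
  let M : Submodule ℚ V := LinearMap.ker (s + 1)
  have hP : ∀ v, v ∈ P ↔ s v = v := fun v => by simp [P, sub_eq_zero]
  have hM : ∀ v, v ∈ M ↔ s v = -v := fun v => by simp [M, add_eq_zero_iff_eq_neg]
  have hsplit : ∀ v, ∃ a ∈ P, ∃ b ∈ M, v = a + b := fun v => by
    refine ⟨(1 / 2 : ℚ) • (v + s v), ?_, (1 / 2 : ℚ) • (v - s v), ?_, by module⟩
    · rw [hP, map_smul, map_add, hss, add_comm]
    · rw [hM, map_smul, map_sub, hss]
      module
  have hcompl : IsCompl P M := by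
    refine ⟨?_, ?_⟩
    · rw [Submodule.disjoint_def]
      intro v h1 h2
      rw [hP] at h1
      rw [hM, h1] at h2
      have h3 : (2 : ℚ) • v = 0 := by
        rw [two_smul]
        nth_rewrite 2 [h2]
        exact add_neg_cancel v
      exact (smul_eq_zero.mp h3).resolve_left two_ne_zero
    · rw [codisjoint_iff, eq_top_iff]
      intro v _
      obtain ⟨a, ha, b, hb, rfl⟩ := hsplit v
      exact Submodule.add_mem_sup ha hb
  have hPM : finrank ℚ P ≤ finrank ℚ M := by
    refine LinearMap.finrank_le_finrank_of_injective
      (f := d.restrict (p := P) (q := M) fun v hv => ?_) ?_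
    · rw [hP] at hv
      rw [hM, hsd', hv]
    · intro a b hab
      exact Subtype.ext (hd (congrArg Subtype.val hab))
  have hMP : finrank ℚ M ≤ finrank ℚ P := by
    refine LinearMap.finrank_le_finrank_of_injective
      (f := d.restrict (p := M) (q := P) fun v hv => ?_) ?_
    · rw [hM] at hv
      rw [hP, hsd', hv, map_neg, neg_neg]
    · intro a b hab
      exact Subtype.ext (hd (congrArg Subtype.val hab))
  have hsum := Submodule.finrank_add_eq_of_isCompl hcompl
  have hPp : finrank ℚ P = p := by omega
  have heven := even_finrank_of_isAlt_of_nondegenerate (ω.restrict P)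
    (fun v w => halt v w) (fun v hv => ?_)
  · rw [hPp] at heven
    exact (Nat.not_even_iff_odd.mpr hp) heven
  · apply Subtype.ext
    apply hnd
    intro w
    obtain ⟨a, ha, b, hb, rfl⟩ := hsplit w
    have h1 : ω v a = 0 := hv ⟨a, ha⟩
    have h2 := hiso v b
    rw [(hP _).mp v.2, (hM _).mp hb, map_neg] at h2
    rw [map_add, h1, zero_add]
    linarith

/-- A rational space carrying two anticommuting square roots of `-1` has dimension
divisible by `4`. -/
theorem four_dvd_finrank_of_quaternion {x y : Module.End ℚ V} (hx : x * x = -1)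
    (hy : y * y = -1) (hxy : x * y = -(y * x)) : 4 ∣ finrank ℚ V := by
  let B : QuaternionAlgebra.Basis (Module.End ℚ V) (-1 : ℚ) 0 (-1) :=
    { i := x, j := y, k := x * y
      i_mul_i := by simp [hx]
      j_mul_j := by simp [hy]
      i_mul_j := rfl
      j_mul_i := by rw [hxy]; simp }
  let f : Quaternion ℚ →ₐ[ℚ] Module.End ℚ V := B.liftHom
  let : Module (Quaternion ℚ) V := Module.compHom V f.toRingHom
  have : IsScalarTower ℚ (Quaternion ℚ) V := ⟨fun a b v => by
    change f (a • b) v = a • f b v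
    simp⟩
  have h := Module.finrank_mul_finrank ℚ (Quaternion ℚ) V
  rw [Quaternion.finrank_eq_four] at h
  exact ⟨_, h.symm⟩

/-- Two isometries `x`, `y` with `x ^ 2 = ±1`, `y ^ 2 = ±1` of a symplectic space of dimension
`2 * p`, `p` odd, do not anticommute. -/
theorem false_of_anticommuting_of_sq [FiniteDimensional ℚ V] {p : ℕ}
    (hp : Odd p) (hV : finrank ℚ V = 2 * p)
    (ω : LinearMap.BilinForm ℚ V) (halt : ∀ v w, ω v w = -ω w v)
    (hnd : ∀ v, (∀ w, ω v w = 0) → v = 0) {x y : Module.End ℚ V}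
    (hx : x * x = 1 ∨ x * x = -1) (hy : y * y = 1 ∨ y * y = -1)
    (hxiso : ∀ v w, ω (x v) (x w) = ω v w) (hyiso : ∀ v w, ω (y v) (y w) = ω v w)
    (hxy : x * y = -(y * x)) : False := by
  have hinj : ∀ {z : Module.End ℚ V}, (z * z = 1 ∨ z * z = -1) → Function.Injective z := by
    intro z hz a b hab
    have h : (z * z) a = (z * z) b := by simp [hab]
    rcases hz with hz | hz <;> simpa [hz] using h
  have hix := hinj hx
  rcases hx with hx' | hx'
  · exact false_of_anticommuting_involution hp hV ω halt hnd hx' hxiso (hinj hy) hxy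
  rcases hy with hy' | hy'
  · exact false_of_anticommuting_involution hp hV ω halt hnd hy' hyiso hix
      (by rw [hxy, neg_neg])
  obtain ⟨k, hk⟩ := four_dvd_finrank_of_quaternion hx' hy' hxy
  obtain ⟨j, hj⟩ := hp
  omega

/-- A root of the `m`-th cyclotomic polynomial in `End V` defines an action of the cyclotomic
field. -/
theorem exists_algHom_of_aeval_cyclotomic {K : Type*} [Field K] [Algebra ℚ K] {m : ℕ} [NeZero m]
    [IsCyclotomicExtension {m} ℚ K] {ζ : K} (hζ : IsPrimitiveRoot ζ m) {c : Module.End ℚ V}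
    (hc : Polynomial.aeval c (Polynomial.cyclotomic m ℚ) = 0) :
    ∃ f : K →ₐ[ℚ] Module.End ℚ V, f ζ = c := by
  have : CharZero K := algebraRat.charZero K
  have hgen : (hζ.powerBasis ℚ).gen = ζ := hζ.powerBasis_gen ℚ
  have hmin : minpoly ℚ (hζ.powerBasis ℚ).gen = Polynomial.cyclotomic m ℚ := by
    rw [hgen, Polynomial.cyclotomic_eq_minpoly_rat hζ (NeZero.pos m)]
    exact congrArg (@minpoly ℚ K _ _ · ζ) (Subsingleton.elim _ _)
  refine ⟨(hζ.powerBasis ℚ).lift c (by rw [hmin, hc]), ?_⟩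
  exact (congrArg _ hgen.symm).trans ((hζ.powerBasis ℚ).lift_gen c (by rw [hmin, hc]))

/-- The dimension of a rational space acted on by a number field is a multiple of the degree. -/
theorem finrank_dvd_finrank_of_algHom {K : Type*} [Field K] [Algebra ℚ K]
    (f : K →ₐ[ℚ] Module.End ℚ V) : finrank ℚ K ∣ finrank ℚ V := by
  let : Module K V := Module.compHom V f.toRingHom
  have : IsScalarTower ℚ K V := ⟨fun a b v => by
    change f (a • b) v = a • f b v
    simp⟩
  exact ⟨_, (Module.finrank_mul_finrank ℚ K V).symm⟩

/-- If `x` and `y` are invertible and linear over a field `K` acting on `V`, and `x y = z y x`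
with `z ∈ K`, then `z ^ dim_K V = 1`. -/
theorem pow_eq_one_of_commutator_eq_scalar [FiniteDimensional ℚ V] {K : Type*} [Field K] [Algebra ℚ K]
    [FiniteDimensional ℚ K] (f : K →ₐ[ℚ] Module.End ℚ V) {d : ℕ}
    (hd : finrank ℚ K * d = finrank ℚ V) {x y : Module.End ℚ V} (hx : IsUnit x) (hy : IsUnit y)
    (hxf : ∀ a, x * f a = f a * x) (hyf : ∀ a, y * f a = f a * y) {z : K}
    (hz : x * y = f z * (y * x)) : z ^ d = 1 := by
  let : Module K V := Module.compHom V f.toRingHom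
  have hsmul : ∀ (a : K) (v : V), a • v = f a v := fun _ _ => rfl
  have : IsScalarTower ℚ K V := ⟨fun a b v => by simp [hsmul]⟩
  have : FiniteDimensional K V := Module.Finite.of_restrictScalars_finite ℚ K V
  have hdim : finrank K V = d := by
    have h := Module.finrank_mul_finrank ℚ K V
    rw [← hd] at h
    exact Nat.eq_of_mul_eq_mul_left finrank_pos h
  let lift : ∀ u : Module.End ℚ V, (∀ a, u * f a = f a * u) → Module.End K V := fun u hu =>
    { toFun := u
      map_add' := u.map_add
      map_smul' := fun a v => by simpa [hsmul] using LinearMap.congr_fun (hu a) v }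
  have hlift : ∀ u hu, IsUnit u → LinearMap.det (lift u hu) ≠ 0 := by
    intro u hu hunit hdet
    have := LinearMap.bot_lt_ker_of_det_eq_zero hdet
    refine this.ne' (LinearMap.ker_eq_bot.mpr ?_)
    exact ((Module.End.isUnit_iff u).mp hunit).1
  have hmul : lift x hxf * lift y hyf = z • (lift y hyf * lift x hxf) := by
    ext v
    exact LinearMap.congr_fun hz v
  have h := congrArg LinearMap.det hmul
  rw [LinearMap.det_smul, map_mul, map_mul, hdim, mul_comm (LinearMap.det (lift y hyf))] at h
  exact (mul_eq_right₀ (mul_ne_zero (hlift x hxf hx) (hlift y hyf hy))).mp h.symm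

end LinearAlgebra

section FixedPoints

open Module

variable {V : Type*} [AddCommGroup V] [Module ℚ V]

/-- A finite abelian group acting on a nonzero rational space so that nontrivial elements have no
nonzero fixed vectors is cyclic. -/
theorem isCyclic_of_fixedPointFree [Nontrivial V] {C : Type*} [CommGroup C] [Finite C]
    (ρ : Representation ℚ C V) (hfree : ∀ c, c ≠ 1 → ∀ v, ρ c v = v → v = 0) : IsCyclic C := by
  let f := ρ.asAlgebraHom
  have hker : RingHom.ker f ≠ ⊤ := RingHom.ker_ne_top f
  obtain ⟨M, hM, hIM⟩ := Ideal.exists_le_maximal _ hker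
  let q := Ideal.Quotient.mk M
  let _ : Field (MonoidAlgebra ℚ C ⧸ M) := Ideal.Quotient.field M
  have : CharZero (MonoidAlgebra ℚ C ⧸ M) := algebraRat.charZero _
  let χ : C →* MonoidAlgebra ℚ C ⧸ M := (q : _ →* _).comp (MonoidAlgebra.of ℚ C)
  refine isCyclic_of_injective_ringHom χ ?_
  rw [injective_iff_map_eq_one]
  intro c hc
  by_contra hne
  have hgeom : ∑ i ∈ Finset.range (orderOf c), ρ c ^ i = 0 := by
    ext v
    refine hfree c hne _ ?_
    have h : (ρ c - 1) * ∑ i ∈ Finset.range (orderOf c), ρ c ^ i = 0 := by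
      rw [mul_geom_sum, ← map_pow, pow_orderOf_eq_one, map_one, sub_self]
    simpa [sub_eq_zero] using LinearMap.congr_fun h v
  have hmem : ∑ i ∈ Finset.range (orderOf c), MonoidAlgebra.of ℚ C c ^ i ∈ M := by
    apply hIM
    rw [RingHom.mem_ker, map_sum, ← hgeom]
    refine Finset.sum_congr rfl fun i _ => ?_
    rw [map_pow]
    congr 1
    exact ρ.asAlgebraHom_of c
  have h := Ideal.Quotient.eq_zero_iff_mem.mpr hmem
  have hc' : Ideal.Quotient.mk M (MonoidAlgebra.of ℚ C c) = 1 := hc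
  rw [map_sum] at h
  simp only [map_pow, hc', one_pow, Finset.sum_const, Finset.card_range, nsmul_eq_mul,
    mul_one, Nat.cast_eq_zero] at h
  exact (orderOf_pos c).ne' h

/-- An endomorphism of order `m`, no nontrivial power of which has a nonzero fixed vector, is a
root of the `m`-th cyclotomic polynomial. -/
theorem aeval_cyclotomic_eq_zero_of_fixedPointFree {c : Module.End ℚ V} {m : ℕ} (hm : 0 < m)
    (hc : c ^ m = 1) (hfree : ∀ d, d ∣ m → d ≠ m → ∀ v, (c ^ d) v = v → v = 0) :
    Polynomial.aeval c (Polynomial.cyclotomic m ℚ) = 0 := by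
  have hinj : ∀ s : Finset ℕ, (∀ d ∈ s, d ∈ m.properDivisors) → ∀ v,
      Polynomial.aeval c (∏ d ∈ s, Polynomial.cyclotomic d ℚ) v = 0 → v = 0 := by
    intro s
    induction s using Finset.induction_on with
    | empty => intro _ v hv; simpa using hv
    | insert d s hd ih =>
      intro hs v hv
      rw [Finset.prod_insert hd, map_mul, Module.End.mul_apply] at hv
      have hd' := Nat.mem_properDivisors.mp (hs d (Finset.mem_insert_self d s))
      refine ih (fun x hx => hs x (Finset.mem_insert_of_mem hx)) v ?_
      refine hfree d hd'.1 hd'.2.ne _ ?_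
      obtain ⟨r, hr⟩ := Polynomial.cyclotomic.dvd_X_pow_sub_one d ℚ
      have h := congrArg (Polynomial.aeval c) (hr.trans (mul_comm _ _))
      rw [map_mul] at h
      have h2 := LinearMap.congr_fun h
        (Polynomial.aeval c (∏ d ∈ s, Polynomial.cyclotomic d ℚ) v)
      rw [Module.End.mul_apply, hv, map_zero] at h2
      simpa [sub_eq_zero] using h2
  have hprod := congrArg (Polynomial.aeval c) (Polynomial.prod_cyclotomic_eq_X_pow_sub_one hm ℚ)
  rw [← Nat.insert_self_properDivisors hm.ne', Finset.prod_insert Nat.self_notMem_properDivisors,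
    mul_comm, map_mul, map_sub, map_pow, Polynomial.aeval_X, hc, map_one, sub_self] at hprod
  ext v
  exact hinj m.properDivisors (fun _ h => h) _ (LinearMap.congr_fun hprod v)

variable {G : Type*} [Group G]

/-- The subgroup of elements fixing a vector. -/
def vectorStabilizer (ρ : Representation ℚ G V) (v : V) : Subgroup G where
  carrier := {g | ρ g v = v}
  one_mem' := by simp
  mul_mem' {a b} ha hb := by
    simp only [Set.mem_ofPred_eq] at ha hb ⊢
    rw [map_mul, Module.End.mul_apply, hb, ha]
  inv_mem' {a} ha := by
    simp only [Set.mem_ofPred_eq] at ha ⊢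
    conv_lhs => rw [← ha]
    rw [← Module.End.mul_apply, ← map_mul, inv_mul_cancel, map_one, Module.End.one_apply]

/-- The subspace of vectors fixed by a subgroup. -/
def fixedSubmodule (ρ : Representation ℚ G V) (K : Subgroup G) : Submodule ℚ V where
  carrier := {v | ∀ k ∈ K, ρ k v = v}
  zero_mem' k _ := map_zero _
  add_mem' ha hb k hk := by rw [map_add, ha k hk, hb k hk]
  smul_mem' a v hv k hk := by rw [map_smul, hv k hk]

/-- In a primitive symplectic representation, nontrivial elements of normal abelian subgroups have
no nonzero fixed vectors. -/
theorem fixedPointFree_of_normal_of_comm [Finite G] (ρ : Representation ℚ G V)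
    (hρ : Function.Injective ρ) (ω : LinearMap.BilinForm ℚ V)
    (hω : ∀ g v w, ω (ρ g v) (ρ g w) = ω v w)
    (hprim : ∀ W : Submodule ℚ V, (∀ g, W.map (ρ g) = W ∨ ∀ v ∈ W, ∀ w ∈ W, ω v (ρ g w) = 0) →
      W = ⊥ ∨ W = ⊤)
    (C : Subgroup G) [C.Normal] (hcomm : ∀ x ∈ C, ∀ y ∈ C, x * y = y * x) {c : G} (hc : c ∈ C)
    (hc1 : c ≠ 1) (v : V) (hv : ρ c v = v) : v = 0 := by
  classical
  by_contra hv0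
  have hFst : ∀ K v, v ∈ fixedSubmodule ρ K ↔ K ≤ vectorStabilizer ρ v := fun _ _ => Iff.rfl
  have hF : ∀ K v, v ∈ fixedSubmodule ρ K ↔ ∀ k ∈ K, ρ k v = v := fun _ _ => Iff.rfl
  have hinv : ∀ g v, ρ g⁻¹ (ρ g v) = v := fun g v => by
    rw [← Module.End.mul_apply, ← map_mul, inv_mul_cancel, map_one, Module.End.one_apply]
  obtain ⟨K, hcK, hK⟩ := (Set.toFinite
    {K : Subgroup G | K ≤ C ∧ fixedSubmodule ρ K ≠ ⊥}).exists_le_maximal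
    (a := Subgroup.zpowers c) ⟨by simpa using hc, fun h => hv0 <| by
      have hvF : v ∈ fixedSubmodule ρ (Subgroup.zpowers c) := by
        rw [hFst, Subgroup.zpowers_le]
        exact hv
      rw [h] at hvF
      simpa using hvF⟩
  obtain ⟨⟨hKC, hKne⟩, hmax⟩ := hK
  have hconj : ∀ g w, w ∈ fixedSubmodule ρ K →
      ρ g w ∈ fixedSubmodule ρ (K.map (MulAut.conj g).toMonoidHom) := by
    rintro g w hw _ ⟨k, hk, rfl⟩
    have h := (hF K w).mp hw k hk
    simp only [MulEquiv.toMonoidHom_eq_coe, MonoidHom.coe_coe, MulAut.conj_apply, map_mul,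
      Module.End.mul_apply, hinv, h]
  have hblock : ∀ g, (fixedSubmodule ρ K).map (ρ g) = fixedSubmodule ρ K ∨
      ∀ v ∈ fixedSubmodule ρ K, ∀ w ∈ fixedSubmodule ρ K, ω v (ρ g w) = 0 := by
    intro g
    set K' := K.map (MulAut.conj g).toMonoidHom with hK'
    have hcard : Nat.card K' = Nat.card K :=
      Nat.card_congr (K.equivMapOfInjective _ (MulAut.conj g).injective).symm.toEquiv
    have hK'C : K' ≤ C := by
      rintro _ ⟨k, hk, rfl⟩
      exact Subgroup.Normal.conj_mem inferInstance k (hKC hk) g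
    by_cases hle : K' ≤ K
    · left
      have heq : K' = K := Subgroup.eq_of_le_of_card_ge hle hcard.ge
      have hsub : (fixedSubmodule ρ K).map (ρ g) ≤ fixedSubmodule ρ K := by
        rintro _ ⟨w, hw, rfl⟩
        rw [← heq]
        exact hconj g w hw
      have hpow : ∀ n : ℕ, ∀ w ∈ fixedSubmodule ρ K, ρ (g ^ n) w ∈ fixedSubmodule ρ K := by
        intro n
        induction n with
        | zero => simp
        | succ n ih =>
          intro w hw
          rw [pow_succ, map_mul, Module.End.mul_apply]
          exact ih _ (hsub ⟨w, hw, rfl⟩)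
      refine le_antisymm hsub fun w hw => ⟨ρ (g ^ (orderOf g - 1)) w, hpow _ w hw, ?_⟩
      rw [← Module.End.mul_apply, ← map_mul, ← pow_succ', Nat.sub_add_cancel (orderOf_pos g),
        pow_orderOf_eq_one, map_one, Module.End.one_apply]
    · right
      intro x hx w hw
      let _ := Fintype.ofFinite K
      have hw' := hconj g w hw
      rw [← hK'] at hw'
      set u : V := ∑ k : K, ρ k (ρ g w) with hu
      have huK : u ∈ fixedSubmodule ρ K := by
        rw [hF]
        intro k hk
        rw [hu, map_sum]
        refine Fintype.sum_equiv (Equiv.mulLeft (⟨k, hk⟩ : K)) _ _ fun j => ?_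
        simp
      have huK' : u ∈ fixedSubmodule ρ K' := by
        rw [hF]
        intro k hk
        rw [hu, map_sum]
        refine Finset.sum_congr rfl fun j _ => ?_
        rw [← Module.End.mul_apply, ← map_mul, hcomm k (hK'C hk) j (hKC j.2), map_mul,
          Module.End.mul_apply, hw' k hk]
      have hu0 : u = 0 := by
        by_contra hne
        refine hle (le_sup_right.trans (hmax (y := K ⊔ K') ⟨sup_le hKC hK'C, fun hbot => hne ?_⟩
          le_sup_left))
        have : u ∈ fixedSubmodule ρ (K ⊔ K') := by
          rw [hFst]
          exact sup_le huK huK'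
        rw [hbot] at this
        simpa using this
      have hsum : ω x u = Fintype.card K • ω x (ρ g w) := by
        rw [hu, map_sum, ← Finset.card_univ, ← Finset.sum_const]
        refine Finset.sum_congr rfl fun k _ => ?_
        conv_lhs => rw [← hx k k.2]
        exact hω _ _ _
      rw [hu0, map_zero, eq_comm, smul_eq_zero] at hsum
      exact hsum.resolve_left Fintype.card_ne_zero
  rcases hprim (fixedSubmodule ρ K) hblock with h | h
  · exact hKne h
  · refine hc1 (hρ ?_)
    ext w
    rw [map_one, Module.End.one_apply]
    have hw : w ∈ fixedSubmodule ρ K := h ▸ Submodule.mem_top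
    exact hw c (hcK (Subgroup.mem_zpowers c))

end FixedPoints

section Arithmetic

/-- For a prime `p ≥ 5`, the moduli whose totient divides `2 * p`. -/
theorem eq_small_or_prime_dvd_of_totient_dvd {p m : ℕ} (hp : p.Prime) (hp5 : 5 ≤ p) (hm : 0 < m)
    (h : m.totient ∣ 2 * p) :
    (m = 1 ∨ m = 2 ∨ m = 3 ∨ m = 4 ∨ m = 6) ∨ ((2 * p + 1).Prime ∧ 2 * p + 1 ∣ m) := by
  have hodd : ¬ 2 ∣ p := fun h2 => by
    have := (Nat.prime_dvd_prime_iff_eq Nat.prime_two hp).mp h2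
    omega
  have hp3 : ¬ 3 ∣ p := fun h3 => by
    have := (Nat.prime_dvd_prime_iff_eq Nat.prime_three hp).mp h3
    omega
  have hdvd : ∀ k, k ∣ m → k.totient ∣ 2 * p := fun k hk =>
    (Nat.totient_dvd_of_dvd hk).trans h
  by_cases hq : (2 * p + 1).Prime ∧ 2 * p + 1 ∣ m
  · exact Or.inr hq
  left
  have hprime : ∀ r, r.Prime → r ∣ m → r = 2 ∨ r = 3 := by
    intro r hr hrm
    have h1 := hdvd r hrm
    rw [Nat.totient_prime hr] at h1
    by_contra hne
    push Not at hne
    have h2 := hr.two_le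
    have hrodd : r % 2 = 1 := hr.eq_two_or_odd.resolve_left hne.1
    obtain ⟨k, hk⟩ : ∃ k, r = 2 * k + 1 := ⟨r / 2, by omega⟩
    have hkp : k ∣ p := by
      obtain ⟨j, hj⟩ := h1
      refine ⟨j, ?_⟩
      have : 2 * p = 2 * (k * j) := by rw [hj, hk]; simp [mul_assoc]
      omega
    rcases (Nat.dvd_prime hp).mp hkp with rfl | rfl
    · omega
    · exact hq ⟨hk ▸ hr, hk ▸ hrm⟩
  have h8 : ¬ 8 ∣ m := fun h' => by
    have := hdvd 8 h'
    rw [show Nat.totient 8 = 4 by decide] at this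
    omega
  have h9 : ¬ 9 ∣ m := fun h' => by
    have := hdvd 9 h'
    rw [show Nat.totient 9 = 6 by decide] at this
    omega
  have h12 : ¬ 12 ∣ m := fun h' => by
    have := hdvd 12 h'
    rw [show Nat.totient 12 = 4 by decide] at this
    omega
  obtain ⟨a, u, hu, rfl⟩ := Nat.exists_eq_pow_mul_and_not_dvd hm.ne' 2 (by norm_num)
  have hu0 : u ≠ 0 := by rintro rfl; simp at hu
  obtain ⟨b, w, hw, rfl⟩ := Nat.exists_eq_pow_mul_and_not_dvd hu0 3 (by norm_num)
  have hw1 : w = 1 := by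
    by_contra hne
    obtain ⟨r, hr, hrw⟩ := Nat.exists_prime_and_dvd hne
    rcases hprime r hr (hrw.trans (Dvd.intro_left _ (mul_assoc _ _ w))) with rfl | rfl
    · exact hu (hrw.mul_left _)
    · exact hw hrw
  subst hw1
  have ha : a < 3 := by
    by_contra hle
    exact h8 ((pow_dvd_pow 2 (not_lt.mp hle)).mul_right _)
  have hb : b < 2 := by
    by_contra hle
    exact h9 (((pow_dvd_pow 3 (not_lt.mp hle)).mul_right 1).mul_left _)
  interval_cases a <;> interval_cases b <;> simp at h12 ⊢

end Arithmetic

section AbelianNormal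

open Module
open scoped commutatorElement

variable {V : Type*} [AddCommGroup V] [Module ℚ V]

/-- An endomorphism commuting with a primitive root of unity commutes with the cyclotomic field it
generates. -/
theorem commute_algHom_of_commute_primitiveRoot {K A : Type*} [Field K] [Algebra ℚ K] [Ring A]
    [Algebra ℚ A] {m : ℕ} [NeZero m] [IsCyclotomicExtension {m} ℚ K] {ζ : K}
    (hζ : IsPrimitiveRoot ζ m) (f : K →ₐ[ℚ] A) {u : A} (h : u * f ζ = f ζ * u) (a : K) :
    u * f a = f a * u := by
  have ha : a ∈ Algebra.adjoin ℚ {ζ} :=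
    IsCyclotomicExtension.adjoin_primitive_root_eq_top (A := ℚ) hζ ▸ Algebra.mem_top
  induction ha using Algebra.adjoin_induction with
  | mem x hx => rw [Set.mem_singleton_iff.mp hx, h]
  | algebraMap r => rw [AlgHom.commutes, Algebra.commutes]
  | add x y _ _ hx hy => rw [map_add, mul_add, add_mul, hx, hy]
  | mul x y _ _ hx hy => rw [map_mul, ← mul_assoc, hx, mul_assoc, hy, mul_assoc]

/-- A root of the `m`-th cyclotomic polynomial in `End V` extends to an action of a cyclotomic
field. -/
theorem exists_cyclotomic_action {m : ℕ} [NeZero m] {c : Module.End ℚ V}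
    (hc : Polynomial.aeval c (Polynomial.cyclotomic m ℚ) = 0) :
    ∃ (K : Type) (_ : Field K) (_ : Algebra ℚ K) (_ : IsCyclotomicExtension {m} ℚ K) (ζ : K)
      (_ : IsPrimitiveRoot ζ m) (f : K →ₐ[ℚ] Module.End ℚ V), f ζ = c := by
  have hK : IsCyclotomicExtension {m} ℚ (CyclotomicField m ℚ) :=
    CyclotomicField.isCyclotomicExtension m ℚ
  have hζ := IsCyclotomicExtension.zeta_spec m ℚ (CyclotomicField m ℚ)
  obtain ⟨f, hf⟩ := exists_algHom_of_aeval_cyclotomic hζ hc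
  exact ⟨_, _, _, hK, _, hζ, f, hf⟩

/-- A root of `Φ_{2k}` has `k`-th power `-1`. -/
theorem pow_eq_neg_one_of_aeval_cyclotomic {k : ℕ} (hk : 0 < k) {c : Module.End ℚ V}
    (hc : Polynomial.aeval c (Polynomial.cyclotomic (2 * k) ℚ) = 0) : c ^ k = -1 := by
  have : NeZero (2 * k) := ⟨by omega⟩
  obtain ⟨K, _, _, _, ζ, hζ, f, rfl⟩ := exists_cyclotomic_action hc
  have h2 := (hζ.pow (NeZero.pos _) (mul_comm 2 k)).eq_neg_one_of_two_right
  rw [← map_pow, h2, map_neg, map_one]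

/-- In a nilpotent group, an element of order `3` is not inverted by conjugation. -/
theorem eq_one_of_isNilpotent_of_conj_eq_inv {N : Type*} [Group N] [Group.IsNilpotent N] {z n : N}
    (hz : z ^ 3 = 1) (hn : n * z * n⁻¹ = z⁻¹) : z = 1 := by
  have hzn : ⁅z, n⁆ = z ^ 2 := by
    rw [commutatorElement_def, show z * n * z⁻¹ * n⁻¹ = z * (n * z * n⁻¹)⁻¹ by group, hn, inv_inv, pow_two]
  have h4 : z = (z ^ 2) ^ 2 := by
    rw [← pow_mul, show 2 * 2 = 3 + 1 from rfl, pow_add, hz, one_mul, pow_one]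
  have hmem : ∀ k, z ∈ Subgroup.upperCentralSeries N k → z = 1 := by
    intro k
    induction k with
    | zero => simp [Subgroup.upperCentralSeries_zero]
    | succ k ih =>
      intro h
      apply ih
      rw [h4]
      refine pow_mem ?_ 2
      rw [← hzn]
      exact Subgroup.mem_upperCentralSeries_succ_iff.mp h n
  obtain ⟨k, hk⟩ := Group.IsNilpotent.nilpotent N
  exact hmem k (hk ▸ Subgroup.mem_top z)

end AbelianNormal

section NilpotentNormal

open Module
open scoped commutatorElement

variable {V : Type*} [AddCommGroup V] [Module ℚ V] {G : Type*} [Group G]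

/-- A faithful action of `G` on `V` preserving the nondegenerate alternating form `ω`. -/
structure IsSymplecticAction (ρ : Representation ℚ G V) (ω : LinearMap.BilinForm ℚ V) : Prop where
  injective : Function.Injective ρ
  alt : ∀ v w, ω v w = -ω w v
  nondegenerate : ∀ v, (∀ w, ω v w = 0) → v = 0
  map_eq : ∀ g v w, ω (ρ g v) (ρ g w) = ω v w

/-- Every abelian normal subgroup of `G` is cyclic of order `1`, `2`, `3`, `4` or `6`, with a
generator acting as a primitive root of unity. -/
def HasSmallAbelianNormals (ρ : Representation ℚ G V) : Prop :=
  ∀ C : Subgroup G, C.Normal → (∀ x ∈ C, ∀ y ∈ C, x * y = y * x) →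
    ∃ c, C = Subgroup.zpowers c ∧
      (orderOf c = 1 ∨ orderOf c = 2 ∨ orderOf c = 3 ∨ orderOf c = 4 ∨ orderOf c = 6) ∧
      Polynomial.aeval (ρ c) (Polynomial.cyclotomic (orderOf c) ℚ) = 0

variable {ρ : Representation ℚ G V} {ω : LinearMap.BilinForm ℚ V} {p : ℕ}

theorem isUnit_representation (ρ : Representation ℚ G V) (g : G) : IsUnit (ρ g) :=
  (Group.isUnit g).map ρ

/-- A normal subgroup with central commutators is abelian. -/
theorem HasSmallAbelianNormals.comm_of_commutator_central [Finite G] [FiniteDimensional ℚ V]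
    (hab : HasSmallAbelianNormals ρ) (hω : IsSymplecticAction ρ ω) (hp : p.Prime) (hp5 : 5 ≤ p)
    (hV : finrank ℚ V = 2 * p) (E : Subgroup G) [E.Normal]
    (hE : ∀ x ∈ E, ∀ y ∈ E, ∀ e ∈ E, e * ⁅x, y⁆ = ⁅x, y⁆ * e) :
    ∀ x ∈ E, ∀ y ∈ E, x * y = y * x := by
  have hpodd : Odd p := hp.odd_of_ne_two (by omega)
  obtain ⟨c, hC, hc, hΦ⟩ := hab (E ⊓ Subgroup.centralizer E) inferInstance
    fun x hx y hy => (Subgroup.mem_centralizer_iff.mp hx.2 y hy.1).symm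
  have hmemC : ∀ z, z ∈ E → (∀ e ∈ E, e * z = z * e) → ∃ j : ℕ, c ^ j = z := by
    intro z hz hcomm
    have : z ∈ Subgroup.zpowers c := hC ▸ ⟨hz, Subgroup.mem_centralizer_iff.mpr hcomm⟩
    rwa [← mem_powers_iff_mem_zpowers] at this
  have hcC : c ∈ E ⊓ Subgroup.centralizer E := hC ▸ Subgroup.mem_zpowers c
  have hcE : ∀ e ∈ E, e * c = c * e := Subgroup.mem_centralizer_iff.mp hcC.2
  intro x hx y hy
  have hzE : ⁅x, y⁆ ∈ E := by
    rw [commutatorElement_def]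
    exact E.mul_mem (E.mul_mem (E.mul_mem hx hy) (E.inv_mem hx)) (E.inv_mem hy)
  obtain ⟨j, hj⟩ := hmemC _ hzE (hE x hx y hy)
  have hxy : x * y = c ^ j * (y * x) := by
    rw [hj, commutatorElement_def]
    group
  suffices hcj : c ^ j = 1 by rw [hxy, hcj, one_mul]
  by_cases h2 : orderOf c = 2
  · by_contra hne
    have hc2 : c ^ 2 = 1 := h2 ▸ pow_orderOf_eq_one c
    have hcn : ρ c = -1 := by
      rw [h2] at hΦ
      simpa using pow_eq_neg_one_of_aeval_cyclotomic (k := 1) one_pos (by simpa using hΦ)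
    have hpow : ∀ i : ℕ, c ^ i = 1 ∨ c ^ i = c := by
      intro i
      rw [← Nat.div_add_mod i 2, pow_add, pow_mul, hc2, one_pow, one_mul]
      rcases Nat.mod_two_eq_zero_or_one i with h | h <;> simp [h]
    have hzc : c ^ j = c := (hpow j).resolve_left hne
    have hsq : ∀ u ∈ E, ρ u * ρ u = 1 ∨ ρ u * ρ u = -1 := by
      intro u hu
      obtain ⟨i, hi⟩ := hmemC (u * u) (E.mul_mem hu hu) (by
        intro e he
        have hue : ⁅u, e⁆ ∈ E := by
          rw [commutatorElement_def]
          exact E.mul_mem (E.mul_mem (E.mul_mem hu he) (E.inv_mem hu)) (E.inv_mem he)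
        obtain ⟨k, hk⟩ := hmemC _ hue (hE u hu e he)
        have hku : u * e = c ^ k * (e * u) := by
          rw [hk, commutatorElement_def]
          group
        rcases hpow k with h1 | h1
        · rw [h1, one_mul] at hku
          rw [← mul_assoc, ← hku, mul_assoc, ← hku, mul_assoc]
        · rw [h1] at hku
          calc e * (u * u) = c ^ 2 * (e * u * u) := by rw [hc2, one_mul, mul_assoc]
            _ = c * (c * (e * u)) * u := by simp only [pow_two, mul_assoc]
            _ = c * u * (e * u) := by rw [← hku]; simp only [mul_assoc]
            _ = u * (c * (e * u)) := by rw [← hcE u hu, mul_assoc]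
            _ = u * u * e := by rw [← hku, mul_assoc])
      rw [← map_mul, ← hi]
      rcases hpow i with h1 | h1 <;> rw [h1]
      · exact Or.inl (map_one ρ)
      · exact Or.inr hcn
    refine false_of_anticommuting_of_sq hpodd hV ω hω.alt hω.nondegenerate (hsq x hx) (hsq y hy)
      (hω.map_eq x) (hω.map_eq y) ?_
    rw [← map_mul, hxy, hzc, map_mul, map_mul, hcn, neg_one_mul]
  · have hm : orderOf c ≠ 0 := (orderOf_pos c).ne'
    have : NeZero (orderOf c) := ⟨hm⟩
    obtain ⟨K, _, _, _, ζ, hζ, f, hf⟩ := exists_cyclotomic_action hΦ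
    have : FiniteDimensional ℚ K := IsCyclotomicExtension.finiteDimensional {orderOf c} ℚ K
    have hfin : finrank ℚ K = (orderOf c).totient :=
      IsCyclotomicExtension.finrank K (Polynomial.cyclotomic.irreducible_rat (orderOf_pos c))
    have hcommf : ∀ u ∈ E, ∀ a, ρ u * f a = f a * ρ u := by
      intro u hu
      refine commute_algHom_of_commute_primitiveRoot hζ f ?_
      rw [hf, ← map_mul, hcE u hu, map_mul]
    by_cases h1 : orderOf c = 1
    · rw [orderOf_eq_one_iff.mp h1, one_pow]
    have htot : (orderOf c).totient = 2 := by
      rcases hc with h | h | h | h | h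
      · exact absurd h h1
      · exact absurd h h2
      all_goals rw [h]; decide
    have hpow := pow_eq_one_of_commutator_eq_scalar f (d := p) (by rw [hfin, htot, hV])
      (isUnit_representation ρ x) (isUnit_representation ρ y) (hcommf x hx) (hcommf y hy)
      (z := ζ ^ j) (by rw [map_pow, hf, ← map_pow, ← map_mul, ← map_mul, ← map_mul, hxy])
    rw [← pow_mul, hζ.pow_eq_one_iff_dvd] at hpow
    have hcop : Nat.Coprime (orderOf c) p := by
      rw [Nat.coprime_comm, Nat.Prime.coprime_iff_not_dvd hp]
      intro hdvd
      have := Nat.le_of_dvd (orderOf_pos c) hdvd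
      have h6 : orderOf c = 6 := by omega
      rw [show orderOf c = 6 by omega] at hdvd this
      obtain rfl | rfl : p = 5 ∨ p = 6 := by omega
      · omega
      · norm_num at hp
    exact orderOf_dvd_iff_pow_eq_one.mp (hcop.dvd_of_dvd_mul_right hpow)

/-- The only units modulo `1`, `2`, `3`, `4` and `6` are `±1`. -/
theorem succ_eq_of_gcd_eq_one {m j : ℕ} (hm : m = 1 ∨ m = 2 ∨ m = 3 ∨ m = 4 ∨ m = 6) (hj : j < m)
    (hcop : m.gcd j = 1) (hj1 : j ≠ 1) : j + 1 = m := by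
  rcases hm with rfl | rfl | rfl | rfl | rfl <;> interval_cases j <;> simp_all

/-- Normal nilpotent subgroups are abelian. -/
theorem HasSmallAbelianNormals.comm_of_isNilpotent [Finite G] [FiniteDimensional ℚ V]
    (hab : HasSmallAbelianNormals ρ) (hω : IsSymplecticAction ρ ω) (hp : p.Prime) (hp5 : 5 ≤ p)
    (hV : finrank ℚ V = 2 * p) (N : Subgroup G) [N.Normal] [Group.IsNilpotent N] :
    ∀ x ∈ N, ∀ y ∈ N, x * y = y * x := by
  have hpodd : Odd p := hp.odd_of_ne_two (by omega)
  obtain ⟨C, -, ⟨hCn, hCcomm, hCN⟩, hCmax⟩ := (Set.toFinite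
    {C : Subgroup G | C.Normal ∧ (∀ x ∈ C, ∀ y ∈ C, x * y = y * x) ∧ C ≤ N}).exists_le_maximal
    (a := ⊥) ⟨inferInstance, by simp, bot_le⟩
  set D : Subgroup G := N ⊓ Subgroup.centralizer C with hD
  have hDnil : Group.IsNilpotent D :=
    Group.nilpotent_of_mulEquiv (Subgroup.subgroupOfEquivOfLe (inf_le_left : D ≤ N))
  have hCD : C ≤ D := le_inf hCN fun x hx =>
    Subgroup.mem_centralizer_iff.mpr fun y hy => hCcomm y hy x hx
  have hlift : ∀ i, (∀ x ∈ Subgroup.upperCentralSeries D i,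
      ∀ y ∈ Subgroup.upperCentralSeries D i, x * y = y * x) →
      C.subgroupOf D ≤ Subgroup.upperCentralSeries D i →
      Subgroup.upperCentralSeries D i ≤ C.subgroupOf D := by
    intro i hcomm hle
    have hmem := hCmax (y := (Subgroup.upperCentralSeries D i).map D.subtype) ⟨inferInstance, by
        rintro _ ⟨x, hx, rfl⟩ _ ⟨y, hy, rfl⟩
        exact congrArg D.subtype (hcomm x hx y hy), by
        rintro _ ⟨x, hx, rfl⟩
        exact x.2.1⟩ (fun x hx => ⟨⟨x, hCD hx⟩, hle hx, rfl⟩)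
    exact fun x hx => hmem ⟨x, hx, rfl⟩
  have hC1 : C.subgroupOf D ≤ Subgroup.upperCentralSeries D 1 := by
    intro x hx
    rw [Subgroup.upperCentralSeries_one, Subgroup.mem_center_iff]
    intro y
    exact Subtype.ext (Subgroup.mem_centralizer_iff.mp y.2.2 x hx).symm
  have hC2 : C.subgroupOf D ≤ Subgroup.upperCentralSeries D 2 :=
    hC1.trans (Subgroup.upperCentralSeries_mono D one_le_two)
  have hcenter : ∀ x ∈ Subgroup.upperCentralSeries D 1, ∀ y, y * x = x * y := by
    intro x hx
    rw [Subgroup.upperCentralSeries_one] at hx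
    exact Subgroup.mem_center_iff.mp hx
  have hcomm2 : ∀ x ∈ Subgroup.upperCentralSeries D 2,
      ∀ y ∈ Subgroup.upperCentralSeries D 2, x * y = y * x := by
    have h := hab.comm_of_commutator_central hω hp hp5 hV
      ((Subgroup.upperCentralSeries D 2).map D.subtype) (by
        rintro _ ⟨x, hx, rfl⟩ _ ⟨y, hy, rfl⟩ _ ⟨e, he, rfl⟩
        exact congrArg D.subtype
          (hcenter _ (Subgroup.mem_upperCentralSeries_succ_iff.mp hx y) e))
    exact fun x hx y hy => Subtype.ext (h x ⟨x, hx, rfl⟩ y ⟨y, hy, rfl⟩)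
  have htop : Subgroup.upperCentralSeries D 1 = ⊤ :=
    Subgroup.upperCentralSeries.eq_top (by norm_num : (1 : ℕ) ≠ 2)
      (le_antisymm (Subgroup.upperCentralSeries_mono D one_le_two)
        ((hlift 2 hcomm2 hC2).trans hC1))
  have hDC : D ≤ C := fun x hx =>
    hlift 1 (fun x hx y _ => (hcenter x hx y).symm) hC1 (x := ⟨x, hx⟩)
      (htop ▸ Subgroup.mem_top _)
  by_cases hNC : N ≤ Subgroup.centralizer C
  · intro x hx y hy
    exact hCcomm x (hDC ⟨hx, hNC hx⟩) y (hDC ⟨hy, hNC hy⟩)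
  exfalso
  obtain ⟨n, hnN, hnC⟩ := SetLike.not_le_iff_exists.mp hNC
  obtain ⟨c, rfl, hc, hΦ⟩ := hab C hCn hCcomm
  have hcC : c ∈ Subgroup.zpowers c := Subgroup.mem_zpowers c
  have hnc : n * c * n⁻¹ ≠ c := by
    intro h
    apply hnC
    rw [Subgroup.mem_centralizer_iff]
    rintro _ ⟨k, rfl⟩
    exact (Commute.zpow_left (mul_inv_eq_iff_eq_mul.mp h).symm k)
  obtain ⟨k, hk⟩ : ∃ k : ℕ, c ^ k = n * c * n⁻¹ := by
    have := hCn.conj_mem c hcC n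
    rwa [← mem_powers_iff_mem_zpowers] at this
  rw [← pow_mod_orderOf] at hk
  have hpos := orderOf_pos c
  have hklt := Nat.mod_lt k hpos
  have hcop : Nat.gcd (orderOf c) (k % orderOf c) = 1 := by
    have h1 : orderOf (n * c * n⁻¹) = orderOf c := by
      have := orderOf_injective (MulAut.conj n).toMonoidHom (MulAut.conj n).injective c
      simpa using this
    rw [← hk, orderOf_pow] at h1
    have hd := Nat.gcd_dvd_left (orderOf c) (k % orderOf c)
    have h3 := Nat.div_mul_cancel hd
    rw [h1] at h3
    exact Nat.eq_of_mul_eq_mul_left hpos (by rw [h3, mul_one])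
  generalize k % orderOf c = j at hk hklt hcop
  have hinv : n * c * n⁻¹ = c⁻¹ := by
    have hj1 : j ≠ 1 := by
      rintro rfl
      exact hnc (by rw [← hk, pow_one])
    have hjm : j + 1 = orderOf c := by
      exact succ_eq_of_gcd_eq_one hc hklt hcop hj1
    rw [← hk, eq_inv_iff_mul_eq_one, ← pow_succ, hjm, pow_orderOf_eq_one]
  have hinvpow : ∀ i : ℕ, n * c ^ i * n⁻¹ = (c ^ i)⁻¹ := by
    intro i
    rw [← conj_pow, hinv, inv_pow]
  have hthree : ∀ i : ℕ, orderOf c = 3 * i → 0 < i → False := by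
    intro i hi hi0
    have h1 : (⟨c ^ i, hCN (pow_mem hcC i)⟩ : N) = 1 :=
      eq_one_of_isNilpotent_of_conj_eq_inv (n := ⟨n, hnN⟩)
        (Subtype.ext (by simp [← pow_mul, mul_comm i 3, ← hi, pow_orderOf_eq_one]))
        (Subtype.ext (hinvpow i))
    have h2 : c ^ i = 1 := congrArg Subtype.val h1
    have := Nat.le_of_dvd hi0 (orderOf_dvd_of_pow_eq_one h2)
    omega
  have h4 : orderOf c = 4 := by
    rcases hc with h | h | h | h | h
    · exact absurd (by rw [orderOf_eq_one_iff.mp h]; group) hnc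
    · refine absurd ?_ hnc
      rw [hinv, inv_eq_iff_mul_eq_one, ← pow_two, ← h, pow_orderOf_eq_one]
    · exact (hthree 1 h one_pos).elim
    · exact h
    · exact (hthree 2 h two_pos).elim
  have hc2 : ρ c ^ 2 = -1 := pow_eq_neg_one_of_aeval_cyclotomic two_pos (by rwa [h4] at hΦ)
  obtain ⟨i, hi⟩ : ∃ i : ℕ, c ^ i = n * n := by
    have : n * n ∈ Subgroup.zpowers c := by
      refine hDC ⟨N.mul_mem hnN hnN, Subgroup.mem_centralizer_iff.mpr ?_⟩
      intro y hy
      obtain ⟨i, rfl⟩ := mem_powers_iff_mem_zpowers.mpr hy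
      have h1 : n * (n * c ^ i * n⁻¹) * n⁻¹ = c ^ i :=
        calc n * (n * c ^ i * n⁻¹) * n⁻¹ = n * (c ^ i)⁻¹ * n⁻¹ := by rw [hinvpow]
          _ = (n * c ^ i * n⁻¹)⁻¹ := by simp only [_root_.mul_inv_rev, inv_inv, mul_assoc]
          _ = c ^ i := by rw [hinvpow, inv_inv]
      simp only
      conv_lhs => rw [← h1]
      group
    rwa [← mem_powers_iff_mem_zpowers] at this
  have hi2 : c ^ (2 * i) = 1 := by
    have h1 := hinvpow i
    rw [hi, show n * (n * n) * n⁻¹ = n * n by group, ← hi, eq_inv_iff_mul_eq_one] at h1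
    rw [two_mul, pow_add, h1]
  obtain ⟨l, rfl⟩ : 2 ∣ i := by
    have h1 := orderOf_dvd_of_pow_eq_one hi2
    rw [h4] at h1
    omega
  have hnsq : ρ n * ρ n = 1 ∨ ρ n * ρ n = -1 := by
    rw [← map_mul, ← hi, map_pow, pow_mul, hc2]
    exact neg_one_pow_eq_or _ l
  refine false_of_anticommuting_of_sq hpodd hV ω hω.alt hω.nondegenerate hnsq
    (Or.inr (by rw [← pow_two, hc2])) (hω.map_eq n) (hω.map_eq c) ?_
  have h3 : c⁻¹ = c ^ 2 * c := by
    rw [inv_eq_iff_mul_eq_one, ← pow_succ, ← pow_succ', show 2 + 1 + 1 = orderOf c from h4.symm,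
      pow_orderOf_eq_one]
  rw [← map_mul, mul_inv_eq_iff_eq_mul.mp hinv, h3, map_mul, map_mul, map_pow, hc2, neg_one_mul,
    neg_mul]

theorem isNilpotent_of_comm (N : Subgroup G) (h : ∀ x ∈ N, ∀ y ∈ N, x * y = y * x) :
    Group.IsNilpotent N :=
  ⟨1, by
    rw [Subgroup.upperCentralSeries_one, eq_top_iff]
    exact fun x _ => Subgroup.mem_center_iff.mpr fun y => Subtype.ext (h y y.2 x x.2)⟩

/-- The join of two abelian normal subgroups has central commutators. -/
theorem commutator_central_of_sup (F N : Subgroup G) [F.Normal] [N.Normal]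
    (hF : ∀ x ∈ F, ∀ y ∈ F, x * y = y * x) (hN : ∀ x ∈ N, ∀ y ∈ N, x * y = y * x) :
    ∀ x ∈ F ⊔ N, ∀ y ∈ F ⊔ N, ∀ e ∈ F ⊔ N, e * ⁅x, y⁆ = ⁅x, y⁆ * e := by
  have hcentral : ∀ z ∈ F ⊓ N, ∀ e ∈ F ⊔ N, e * z = z * e := by
    intro z hz e he
    obtain ⟨f, hf, n, hn, rfl⟩ := Subgroup.mem_sup_of_normal_left.mp he
    rw [mul_assoc, hN n hn z hz.2, ← mul_assoc, hF f hf z hz.1, mul_assoc]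
  have hswap : ∀ f ∈ F, ∀ n ∈ N, ∀ f' ∈ F, ∀ n' ∈ N, ∃ z ∈ F ⊓ N,
      f * n * (f' * n') = z * (f * f' * (n * n')) := by
    intro f hf n hn f' hf' n' hn'
    have hz : ⁅n, f'⁆ ∈ F ⊓ N := by
      rw [commutatorElement_def]
      refine ⟨F.mul_mem (Subgroup.Normal.conj_mem inferInstance f' hf' n) (F.inv_mem hf'), ?_⟩
      rw [mul_assoc, mul_assoc, ← mul_assoc f']
      exact N.mul_mem hn (Subgroup.Normal.conj_mem inferInstance _ (N.inv_mem hn) f')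
    refine ⟨_, hz, ?_⟩
    have h1 : n * f' = ⁅n, f'⁆ * (f' * n) := by
      rw [commutatorElement_def]
      group
    calc f * n * (f' * n') = f * (n * f') * n' := by simp only [mul_assoc]
      _ = f * ⁅n, f'⁆ * (f' * n) * n' := by rw [h1, ← mul_assoc]
      _ = ⁅n, f'⁆ * f * (f' * n) * n' := by rw [hF f hf _ hz.1]
      _ = ⁅n, f'⁆ * (f * f' * (n * n')) := by simp only [mul_assoc]
  intro x hx y hy
  obtain ⟨f, hf, n, hn, rfl⟩ := Subgroup.mem_sup_of_normal_left.mp hx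
  obtain ⟨f', hf', n', hn', rfl⟩ := Subgroup.mem_sup_of_normal_left.mp hy
  obtain ⟨z, hz, h1⟩ := hswap f hf n hn f' hf' n' hn'
  obtain ⟨z', hz', h2⟩ := hswap f' hf' n' hn' f hf n hn
  rw [hF f' hf' f hf, hN n' hn' n hn] at h2
  have h3 : ⁅f * n, f' * n'⁆ = z * z'⁻¹ := by
    rw [commutatorElement_def, show f * n * (f' * n') * (f * n)⁻¹ * (f' * n')⁻¹ =
      f * n * (f' * n') * (f' * n' * (f * n))⁻¹ by group, h1, h2]
    group
  rw [h3]
  exact hcentral _ (Subgroup.mul_mem _ hz (Subgroup.inv_mem _ hz'))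

/-- The Fitting subgroup of a symplectic group with small abelian normal subgroups and containing
`-1` is cyclic of order `2`, `4` or `6`. -/
theorem HasSmallAbelianNormals.exists_fitting [Finite G] [FiniteDimensional ℚ V]
    (hab : HasSmallAbelianNormals ρ) (hω : IsSymplecticAction ρ ω) (hp : p.Prime) (hp5 : 5 ≤ p)
    (hV : finrank ℚ V = 2 * p) {s : G} (hs : ρ s = -1) :
    ∃ F : Subgroup G, F.Normal ∧ Group.IsNilpotent F ∧
      (∀ N : Subgroup G, N.Normal → Group.IsNilpotent N → N ≤ F) ∧
      IsCyclic F ∧ (Nat.card F = 2 ∨ Nat.card F = 4 ∨ Nat.card F = 6) := by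
  have hVn : Nontrivial V := nontrivial_of_finrank_pos (R := ℚ) (by omega)
  obtain ⟨F, -, ⟨hFn, hFnil⟩, hmax⟩ := (Set.toFinite
    {F : Subgroup G | F.Normal ∧ Group.IsNilpotent F}).exists_le_maximal
    (a := ⊥) ⟨inferInstance, inferInstance⟩
  have hF := hab.comm_of_isNilpotent hω hp hp5 hV F
  have hle : ∀ N : Subgroup G, N.Normal → Group.IsNilpotent N → N ≤ F := by
    intro N hNn hNnil
    have hN := hab.comm_of_isNilpotent hω hp hp5 hV N
    have hE := hab.comm_of_commutator_central hω hp hp5 hV (F ⊔ N)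
      (commutator_central_of_sup F N hF hN)
    exact le_sup_right.trans (hmax ⟨inferInstance, isNilpotent_of_comm _ hE⟩ le_sup_left)
  obtain ⟨c, rfl, hc, -⟩ := hab F hFn hF
  refine ⟨_, hFn, hFnil, hle, inferInstance, ?_⟩
  have hscomm : ∀ g, g * s = s * g := fun g => hω.injective (by simp [hs])
  have hs1 : s ≠ 1 := by
    rintro rfl
    rw [map_one] at hs
    obtain ⟨v, hv⟩ := exists_ne (0 : V)
    have h1 : v = -v := by simpa using LinearMap.congr_fun hs v
    have h2 : (2 : ℚ) • v = 0 := by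
      rw [two_smul]
      nth_rewrite 2 [h1]
      exact add_neg_cancel v
    exact hv ((smul_eq_zero.mp h2).resolve_left two_ne_zero)
  have hs2 : s ^ 2 = 1 := hω.injective (by simp [hs])
  have hsF : s ∈ Subgroup.zpowers c := by
    refine hle (Subgroup.zpowers s) ⟨?_⟩ (isNilpotent_of_comm _ ?_) (Subgroup.mem_zpowers s)
    · rintro _ ⟨k, rfl⟩ g
      refine ⟨k, ?_⟩
      rw [eq_mul_inv_iff_mul_eq]
      exact (Commute.zpow_right (hscomm g) k).symm
    · rintro x ⟨i, rfl⟩ y ⟨j, rfl⟩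
      exact zpow_mul_comm s i j
  have h2 : 2 ∣ orderOf c := by
    rw [← orderOf_eq_prime hs2 hs1]
    exact orderOf_dvd_of_mem_zpowers hsF
  rw [Nat.card_zpowers]
  omega

end NilpotentNormal

section SmallAbelianNormals

open Module

variable {V : Type*} [AddCommGroup V] [Module ℚ V] {G : Type*} [Group G]
  {ρ : Representation ℚ G V} {ω : LinearMap.BilinForm ℚ V} {p : ℕ}

/-- Powers of a generator of a cyclic normal subgroup generate normal subgroups. -/
theorem normal_zpowers_pow {c : G} (hc : (Subgroup.zpowers c).Normal) (k : ℕ) :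
    (Subgroup.zpowers (c ^ k)).Normal := by
  refine ⟨?_⟩
  rintro _ ⟨i, rfl⟩ g
  obtain ⟨j, hj⟩ := hc.conj_mem c (Subgroup.mem_zpowers c) g
  refine ⟨j * i, ?_⟩
  simp only at hj ⊢
  rw [← conj_zpow, ← conj_pow, ← hj, ← zpow_natCast (c ^ j), ← zpow_natCast c,
    ← _root_.zpow_mul, ← _root_.zpow_mul, ← _root_.zpow_mul]
  congr 1
  ring

/-- In a primitive symplectic representation of dimension `2 * p` without normal subgroups of prime
order `2 * p + 1`, all abelian normal subgroups are small. -/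
theorem hasSmallAbelianNormals_of_primitive [Finite G] [FiniteDimensional ℚ V]
    (hω : IsSymplecticAction ρ ω) (hp : p.Prime) (hp5 : 5 ≤ p) (hV : finrank ℚ V = 2 * p)
    (hprim : ∀ W : Submodule ℚ V, (∀ g, W.map (ρ g) = W ∨ ∀ v ∈ W, ∀ w ∈ W, ω v (ρ g w) = 0) →
      W = ⊥ ∨ W = ⊤)
    (hno : (2 * p + 1).Prime → ∀ c : G, (Subgroup.zpowers c).Normal →
      Polynomial.aeval (ρ c) (Polynomial.cyclotomic (2 * p + 1) ℚ) ≠ 0) :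
    HasSmallAbelianNormals ρ := by
  intro C hCn hCcomm
  have hVn : Nontrivial V := nontrivial_of_finrank_pos (R := ℚ) (by omega)
  have hfree : ∀ c ∈ C, c ≠ 1 → ∀ v, ρ c v = v → v = 0 := fun c hc hc1 =>
    fixedPointFree_of_normal_of_comm ρ hω.injective ω hω.map_eq hprim C hCcomm hc hc1
  have hcyc : IsCyclic C := by
    let _ : CommGroup C :=
      { (inferInstance : Group C) with mul_comm := fun x y => Subtype.ext (hCcomm x x.2 y y.2) }
    exact isCyclic_of_fixedPointFree (ρ.comp C.subtype)
      fun c hc => hfree c c.2 fun h => hc (Subtype.ext h)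
  obtain ⟨c, hc⟩ := (Subgroup.isCyclic_iff_exists_zpowers_eq_top C).mp hcyc
  subst hc
  have hcC : c ∈ Subgroup.zpowers c := Subgroup.mem_zpowers c
  have hΦ : ∀ k, k ∣ orderOf c →
      Polynomial.aeval (ρ (c ^ (orderOf c / k))) (Polynomial.cyclotomic k ℚ) = 0 := by
    intro k hk
    have hpos := orderOf_pos c
    have hk0 : 0 < k := Nat.pos_of_dvd_of_pos hk hpos
    refine aeval_cyclotomic_eq_zero_of_fixedPointFree hk0 ?_ fun d hd hdk v hv => ?_
    · rw [← map_pow, ← pow_mul, Nat.div_mul_cancel hk, pow_orderOf_eq_one, map_one]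
    · rw [← map_pow, ← pow_mul] at hv
      refine hfree _ (pow_mem hcC _) (fun h1 => hdk ?_) v hv
      refine Nat.dvd_antisymm hd (Nat.dvd_of_mul_dvd_mul_left
        (Nat.div_pos (Nat.le_of_dvd hpos hk) hk0) ?_)
      rw [Nat.div_mul_cancel hk]
      exact orderOf_dvd_of_pow_eq_one h1
  have hΦ1 := hΦ _ dvd_rfl
  rw [Nat.div_self (orderOf_pos c), pow_one] at hΦ1
  refine ⟨c, rfl, ?_, hΦ1⟩
  have : NeZero (orderOf c) := ⟨(orderOf_pos c).ne'⟩
  obtain ⟨K, _, _, _, ζ, hζ, f, hf⟩ := exists_cyclotomic_action hΦ1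
  have hdvd := finrank_dvd_finrank_of_algHom f
  rw [IsCyclotomicExtension.finrank K (Polynomial.cyclotomic.irreducible_rat (orderOf_pos c)),
    hV] at hdvd
  rcases eq_small_or_prime_dvd_of_totient_dvd hp hp5 (orderOf_pos c) hdvd with h | ⟨hq, hqm⟩
  · exact h
  · exact absurd (hΦ _ hqm) (hno hq _ (normal_zpowers_pow hCn _))

end SmallAbelianNormals

section InvariantForm

open Module

variable {V : Type*} [AddCommGroup V] [Module ℚ V]

/-- A finite group of automorphisms preserves a positive definite form. -/
theorem exists_invariant_posDef [FiniteDimensional ℚ V] (H : Subgroup (End ℚ V)ˣ) [Finite H] :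
    ∃ B : LinearMap.BilinForm ℚ V, (∀ v w, B v w = B w v) ∧ (∀ v, v ≠ 0 → 0 < B v v) ∧
      ∀ h ∈ H, ∀ v w, B ((h : End ℚ V) v) ((h : End ℚ V) w) = B v w := by
  have : Fintype H := Fintype.ofFinite H
  let b := finBasis ℚ V
  let B : LinearMap.BilinForm ℚ V := ∑ h : H, ∑ i, (LinearMap.mul ℚ ℚ).compl₁₂
    (b.coord i ∘ₗ ((h : (End ℚ V)ˣ) : End ℚ V)) (b.coord i ∘ₗ ((h : (End ℚ V)ˣ) : End ℚ V))
  have hB : ∀ v w, B v w = ∑ h : H, ∑ i, b.repr (((h : (End ℚ V)ˣ) : End ℚ V) v) i *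
      b.repr (((h : (End ℚ V)ˣ) : End ℚ V) w) i := fun v w => by
    simp [B, LinearMap.sum_apply]
  refine ⟨B, fun v w => ?_, fun v hv => ?_, fun h hh v w => ?_⟩
  · simp only [hB, mul_comm]
  · rw [hB]
    have hpos : ∀ h ∈ (Finset.univ : Finset H),
        0 ≤ ∑ i, b.repr (((h : (End ℚ V)ˣ) : End ℚ V) v) i *
          b.repr (((h : (End ℚ V)ˣ) : End ℚ V) v) i :=
      fun h _ => Finset.sum_nonneg fun i _ => mul_self_nonneg _
    refine lt_of_le_of_ne (Finset.sum_nonneg hpos) fun h0 => hv ?_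
    have h1 := (Finset.sum_eq_zero_iff_of_nonneg hpos).mp h0.symm 1 (Finset.mem_univ _)
    rw [Finset.sum_eq_zero_iff_of_nonneg fun i _ => mul_self_nonneg _] at h1
    refine b.ext_elem fun i => ?_
    simpa using h1 i (Finset.mem_univ _)
  · rw [hB, hB]
    refine Fintype.sum_equiv (Equiv.mulRight (⟨h, hh⟩ : H)) _ _ fun k => ?_
    simp

/-- A finite group of automorphisms commuting with a square root of `-n`, `n > 0`, is
symplectic. -/
theorem exists_invariant_symplectic_of_commute [FiniteDimensional ℚ V] (H : Subgroup (End ℚ V)ˣ)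
    [Finite H] {J : End ℚ V} {n : ℚ} (hn : 0 < n) (hJ : ∀ v, J (J v) = -(n • v))
    (hcomm : ∀ h ∈ H, ∀ v, (h : End ℚ V) (J v) = J ((h : End ℚ V) v)) :
    ∃ ω : LinearMap.BilinForm ℚ V, (∀ v w, ω v w = -ω w v) ∧
      (∀ v, (∀ w, ω v w = 0) → v = 0) ∧
      ∀ h ∈ H, ∀ v w, ω ((h : End ℚ V) v) ((h : End ℚ V) w) = ω v w := by
  obtain ⟨B, hsymm, hpos, hinv⟩ := exists_invariant_posDef H
  refine ⟨B.compl₁₂ J LinearMap.id - B.compl₁₂ LinearMap.id J, fun v w => ?_, fun v hv => ?_,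
    fun h hh v w => ?_⟩
  · simp [hsymm v (J w), hsymm (J v) w]
  · by_contra hne
    have h1 := hv (J v)
    simp only [LinearMap.sub_apply, LinearMap.compl₁₂_apply, LinearMap.id_apply, hJ, map_neg,
      map_smul, smul_eq_mul, sub_neg_eq_add] at h1
    have h2 := mul_pos hn (hpos v hne)
    have h3 : 0 ≤ B (J v) (J v) := by
      rcases eq_or_ne (J v) 0 with h0 | h0
      · simp [h0]
      · exact (hpos _ h0).le
    linarith
  · simp only [LinearMap.sub_apply, LinearMap.compl₁₂_apply, LinearMap.id_apply, ← hcomm h hh,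
      hinv h hh]

end InvariantForm

section GaussSums

variable {q : ℕ} [Fact q.Prime] {K : Type*} [Field K]

/-- The quadratic character of `ℤ/q` with values in `K`. -/
noncomputable def legendreChar (q : ℕ) [Fact q.Prime] (K : Type*) [Field K] : MulChar (ZMod q) K :=
  (quadraticChar (ZMod q)).ringHomComp (Int.castRingHom K)

theorem legendreChar_apply (x : ZMod q) :
    legendreChar q K x = ((quadraticChar (ZMod q) x : ℤ) : K) := rfl

theorem legendreChar_eq_one_or {x : ZMod q} (hx : x ≠ 0) :
    legendreChar q K x = 1 ∨ legendreChar q K x = -1 := by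
  rcases quadraticChar_dichotomy hx with h | h <;> simp [legendreChar_apply, h]

theorem legendreChar_mul_self {x : ZMod q} (hx : x ≠ 0) :
    legendreChar q K x * legendreChar q K x = 1 := by
  rcases legendreChar_eq_one_or (K := K) hx with h | h <;> simp [h]

theorem legendreChar_sq (r : (ZMod q)ˣ) : legendreChar q K ((r ^ 2 : (ZMod q)ˣ) : ZMod q) = 1 := by
  rw [Units.val_pow_eq_pow_val, map_pow, pow_two, legendreChar_mul_self r.ne_zero]

theorem legendreChar_isQuadratic : (legendreChar q K).IsQuadratic :=
  (quadraticChar_isQuadratic (ZMod q)).comp _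

theorem legendreChar_ne_one [CharZero K] (hq : q ≠ 2) : legendreChar q K ≠ 1 :=
  (MulChar.ringHomComp_ne_one_iff (Int.cast_injective)).mpr
    (quadraticChar_ne_one (by rwa [ZMod.ringChar_zmod_n]))

theorem legendreChar_neg_one (hq : q % 4 = 3) : legendreChar q K (-1) = -1 := by
  rw [legendreChar_apply, quadraticChar_neg_one (by rw [ZMod.ringChar_zmod_n]; omega), ZMod.card,
    ZMod.χ₄_nat_three_mod_four hq]
  simp

/-- A sum over `ℤ/q` splits off its value at `0`. -/
theorem sum_zmod_eq_add_sum_units {M : Type*} [AddCommMonoid M] (h : ZMod q → M) :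
    ∑ y, h y = h 0 + ∑ y : (ZMod q)ˣ, h y := by
  rw [Fintype.sum_eq_add_sum_subtype_ne h 0]
  exact congrArg _ (Fintype.sum_equiv unitsEquivNeZero _ _ fun _ => rfl).symm

variable {ψ : AddChar (ZMod q) K}

theorem AddChar.IsPrimitive.injective_zmod (hψ : ψ.IsPrimitive) : Function.Injective ψ := by
  intro x y hxy
  by_contra hne
  have h := (AddChar.zmod_char_ne_one_iff q _).mp (hψ (sub_ne_zero.mpr hne))
  rw [AddChar.mulShift_apply, mul_one, AddChar.map_sub_eq_div, hxy,
    div_self (ψ.val_isUnit y).ne_zero] at h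
  exact h rfl

/-- The quadratic Gauss sum with a linear term. -/
theorem sum_addChar_quadratic [CharZero K] (hq : q ≠ 2) (hψ : ψ.IsPrimitive) {d : ZMod q} (hd : d ≠ 0)
    (c : ZMod q) :
    ∑ y, ψ (d * y ^ 2 + c * y) =
      ψ (-c ^ 2 / (4 * d)) * (legendreChar q K d * gaussSum (legendreChar q K) ψ) := by
  classical
  have h2 : (2 : ZMod q) ≠ 0 := by
    intro h
    have : q ∣ 2 := (ZMod.natCast_eq_zero_iff 2 q).mp (by exact_mod_cast h)
    exact hq ((Nat.prime_dvd_prime_iff_eq Fact.out Nat.prime_two).mp this)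
  have h4 : (4 : ZMod q) ≠ 0 := by
    rw [show (4 : ZMod q) = 2 * 2 by norm_num]
    exact mul_ne_zero h2 h2
  have hpure : ∑ y, ψ (d * y ^ 2) = legendreChar q K d * gaussSum (legendreChar q K) ψ := by
    have hcard : ∀ x : ZMod q, ((Finset.univ.filter fun y : ZMod q => y ^ 2 = x).card : K) =
        legendreChar q K x + 1 := fun x => by
      have := quadraticChar_card_sqrts (F := ZMod q) (by rwa [ZMod.ringChar_zmod_n]) x
      rw [legendreChar_apply, ← Int.cast_one, ← Int.cast_add, ← this, Int.cast_natCast]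
      congr 2
      ext y
      simp
    have hzero : ∑ x, ψ (d * x) = 0 := by
      have := AddChar.sum_mulShift d hψ
      simpa [hd, mul_comm] using this
    calc ∑ y, ψ (d * y ^ 2)
        = ∑ x, ∑ y ∈ Finset.univ.filter fun y : ZMod q => y ^ 2 = x, ψ (d * y ^ 2) :=
          (Finset.sum_fiberwise _ _ _).symm
      _ = ∑ x, (legendreChar q K x + 1) * ψ (d * x) := by
          refine Finset.sum_congr rfl fun x _ => ?_
          rw [← hcard, ← nsmul_eq_mul, ← Finset.sum_const]
          refine Finset.sum_congr rfl fun y hy => ?_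
          rw [(Finset.mem_filter.mp hy).2]
      _ = gaussSum (legendreChar q K) (ψ.mulShift d) := by
          simp only [add_mul, one_mul, Finset.sum_add_distrib, hzero, add_zero]
          rfl
      _ = legendreChar q K d * gaussSum (legendreChar q K) ψ := by
          rw [← gaussSum_mulShift (legendreChar q K) ψ (Units.mk0 d hd), ← mul_assoc,
            Units.val_mk0, legendreChar_mul_self hd, one_mul]
  rw [← hpure, Finset.mul_sum]
  refine Fintype.sum_equiv (Equiv.addRight (c / (2 * d))) _ _ fun y => ?_
  rw [← AddChar.map_add_eq_mul, Equiv.coe_addRight]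
  congr 1
  field_simp
  ring

theorem gaussSum_legendreChar_sq [CharZero K] (hq : q % 4 = 3) (hψ : ψ.IsPrimitive) :
    gaussSum (legendreChar q K) ψ * gaussSum (legendreChar q K) ψ = -(q : K) := by
  have h := gaussSum_sq (χ := legendreChar q K) (legendreChar_ne_one (by omega))
    legendreChar_isQuadratic hψ
  rw [legendreChar_neg_one hq, pow_two, ZMod.card] at h
  rw [h, neg_one_mul]

end GaussSums

section WeilOperator

variable {q : ℕ} [Fact q.Prime] {K : Type*} [Field K] [Algebra ℚ K]

/-- The operator on `ℚ(ζ_q)` by which the Weil representation of `SL₂(q)` represents a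
non-diagonal involution modulo sign. -/
noncomputable def weilOperator (ψ : AddChar (ZMod q) K) (σ : (ZMod q)ˣ →* (K ≃ₐ[ℚ] K)) :
    Module.End ℚ K :=
  ∑ y : (ZMod q)ˣ, LinearMap.mulLeft ℚ
    ((gaussSum (legendreChar q K) ψ)⁻¹ * (legendreChar q K y * ψ y)) ∘ₗ (σ (y ^ 2)).toLinearMap

variable {ψ : AddChar (ZMod q) K} {σ : (ZMod q)ˣ →* (K ≃ₐ[ℚ] K)}

theorem weilOperator_apply (a : K) :
    weilOperator ψ σ a = (gaussSum (legendreChar q K) ψ)⁻¹ *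
      ∑ y : (ZMod q)ˣ, legendreChar q K y * ψ y * σ (y ^ 2) a := by
  simp [weilOperator, LinearMap.sum_apply, Finset.mul_sum, mul_assoc]

theorem map_legendreChar (t : (ZMod q)ˣ) (x : ZMod q) :
    σ t (legendreChar q K x) = legendreChar q K x := by
  rw [legendreChar_apply, map_intCast]

theorem map_gaussSum_of_sq (hσ : ∀ t x, σ t (ψ x) = ψ (t * x)) (r : (ZMod q)ˣ) :
    σ (r ^ 2) (gaussSum (legendreChar q K) ψ) = gaussSum (legendreChar q K) ψ := by
  have h := gaussSum_mulShift (legendreChar q K) ψ (r ^ 2)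
  rw [legendreChar_sq, one_mul] at h
  nth_rewrite 2 [← h]
  simp only [gaussSum, map_sum, map_mul, map_legendreChar, hσ, AddChar.mulShift_apply]

theorem map_weilOperator (hσ : ∀ t x, σ t (ψ x) = ψ (t * x)) (r : (ZMod q)ˣ) (a : K) :
    σ (r ^ 2) (weilOperator ψ σ a) = weilOperator ψ σ (σ (r ^ 2)⁻¹ a) := by
  rw [weilOperator_apply, weilOperator_apply, map_mul, map_inv₀, map_gaussSum_of_sq hσ, map_sum]
  congr 1
  refine Fintype.sum_equiv (Equiv.mulLeft (r ^ 2)) _ _ fun y => ?_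
  simp only [Equiv.coe_mulLeft]
  rw [map_mul (σ (r ^ 2)), map_mul (σ (r ^ 2)), map_legendreChar, hσ, Units.val_mul,
    map_mul (legendreChar q K), legendreChar_sq, one_mul, ← AlgEquiv.mul_apply, ← AlgEquiv.mul_apply, ← map_mul, ← map_mul]
  congr 3
  rw [mul_pow, mul_assoc, mul_comm (y ^ 2), ← mul_assoc, pow_two (r ^ 2), mul_assoc (r ^ 2),
    mul_inv_cancel, mul_one]

theorem weilOperator_gaussSum_mul (hσ : ∀ t x, σ t (ψ x) = ψ (t * x)) (a : K) :
    weilOperator ψ σ (gaussSum (legendreChar q K) ψ * a) =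
      gaussSum (legendreChar q K) ψ * weilOperator ψ σ a := by
  rw [weilOperator_apply, weilOperator_apply, Finset.mul_sum, Finset.mul_sum, Finset.mul_sum]
  refine Finset.sum_congr rfl fun y _ => ?_
  rw [map_mul, map_gaussSum_of_sq hσ]
  ring

/-- The basic composition formula for the Weil operator. -/
theorem weilOperator_mul_weilOperator (hq : q % 4 = 3) (hσ : ∀ t x, σ t (ψ x) = ψ (t * x))
    (b : ZMod q) (a : K) :
    weilOperator ψ σ (ψ b * weilOperator ψ σ a) =
      (gaussSum (legendreChar q K) ψ)⁻¹ * ((gaussSum (legendreChar q K) ψ)⁻¹ *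
      ∑ x : (ZMod q)ˣ, legendreChar q K x * σ (x ^ 2) a *
        ∑ y : ZMod q, ψ (b * y ^ 2 + (1 + x) * y)) := by
  have hanti : ∑ x : (ZMod q)ˣ, legendreChar q K x * σ (x ^ 2) a = 0 := by
    have h : ∑ x : (ZMod q)ˣ, legendreChar q K x * σ (x ^ 2) a =
        -∑ x : (ZMod q)ˣ, legendreChar q K x * σ (x ^ 2) a := by
      rw [← Finset.sum_neg_distrib]
      refine Fintype.sum_equiv (Equiv.neg _) _ _ fun x => ?_
      rw [Equiv.neg_apply, neg_sq, Units.val_neg, ← neg_one_mul (x : ZMod q), map_mul,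
        legendreChar_neg_one hq]
      ring
    have : CharZero K := algebraRat.charZero K
    exact self_eq_neg.mp h
  have hsplit : ∑ x : (ZMod q)ˣ, legendreChar q K x * σ (x ^ 2) a *
      ∑ y : ZMod q, ψ (b * y ^ 2 + (1 + x) * y) =
      ∑ x : (ZMod q)ˣ, legendreChar q K x * σ (x ^ 2) a *
        ∑ y : (ZMod q)ˣ, ψ (b * (y : ZMod q) ^ 2 + (1 + x) * y) := by
    simp only [sum_zmod_eq_add_sum_units fun y => ψ (b * y ^ 2 + (1 + _) * y)]
    simp only [mul_add, Finset.sum_add_distrib]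
    simpa using hanti
  rw [hsplit, weilOperator_apply]
  congr 1
  simp only [Finset.mul_sum]
  rw [Finset.sum_comm]
  refine Finset.sum_congr rfl fun y _ => ?_
  rw [weilOperator_apply, map_mul, map_mul, map_inv₀, map_gaussSum_of_sq hσ, map_sum, hσ,
    Finset.mul_sum, Finset.mul_sum, Finset.mul_sum]
  refine Fintype.sum_equiv (Equiv.mulLeft y) _ _ fun z => ?_
  simp only [Equiv.coe_mulLeft]
  rw [map_mul (σ (y ^ 2)), map_mul (σ (y ^ 2)), map_legendreChar, hσ, mul_pow, map_mul σ,
    AlgEquiv.mul_apply, Units.val_mul, map_mul (legendreChar q K),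
    show b * (y : ZMod q) ^ 2 + (1 + y * z) * y = y + ((y ^ 2 : (ZMod q)ˣ) : ZMod q) * b +
      ((y ^ 2 : (ZMod q)ˣ) : ZMod q) * z by push_cast; ring,
    AddChar.map_add_eq_mul, AddChar.map_add_eq_mul]
  ring

theorem weilOperator_weilOperator (hq : q % 4 = 3) (hψ : ψ.IsPrimitive)
    (hσ : ∀ t x, σ t (ψ x) = ψ (t * x)) (a : K) :
    weilOperator ψ σ (weilOperator ψ σ a) = a := by
  have : CharZero K := algebraRat.charZero K
  have h := weilOperator_mul_weilOperator hq hσ 0 a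
  have hsum : ∀ x : (ZMod q)ˣ, ∑ y : ZMod q, ψ (0 * y ^ 2 + (1 + x) * y) =
      if x = -1 then (q : K) else 0 := fun x => by
    have h1 := AddChar.sum_mulShift (1 + (x : ZMod q)) hψ
    simp only [zero_mul, zero_add, mul_comm (1 + (x : ZMod q))]
    rw [h1, ZMod.card]
    have : 1 + (x : ZMod q) = 0 ↔ x = -1 := by
      rw [Units.ext_iff, Units.val_neg, Units.val_one, add_comm, add_eq_zero_iff_eq_neg]
    simp [this]
  simp only [hsum, mul_ite, mul_zero, Finset.sum_ite_eq', Finset.mem_univ, if_true] at h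
  rw [AddChar.map_zero_eq_one, one_mul] at h
  have hg := gaussSum_legendreChar_sq (K := K) hq hψ
  have hq0 : (q : K) ≠ 0 := Nat.cast_ne_zero.mpr (Fact.out : q.Prime).ne_zero
  rw [h, ← mul_assoc, ← _root_.mul_inv, hg, Units.val_neg, Units.val_one, legendreChar_neg_one hq,
    neg_sq, one_pow, map_one, AlgEquiv.one_apply]
  field_simp

/-- The braid-type relation between the Weil operator and the multiplications by `ψ b`. -/
theorem weilOperator_mul_weilOperator_of_ne_zero (hq : q % 4 = 3) (hψ : ψ.IsPrimitive)
    (hσ : ∀ t x, σ t (ψ x) = ψ (t * x)) {b : ZMod q} (hb : b ≠ 0) :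
    ∃ (ε : ℤˣ) (r : (ZMod q)ˣ) (c : ZMod q), ∀ a,
      weilOperator ψ σ (ψ b * weilOperator ψ σ a) =
        ((ε : ℤ) : K) * (ψ c * σ (r ^ 2) (weilOperator ψ σ (ψ c * a))) := by
  have : CharZero K := algebraRat.charZero K
  have h2 : (2 : ZMod q) ≠ 0 := by
    intro h
    have h' : q ∣ 2 := (ZMod.natCast_eq_zero_iff 2 q).mp (by exact_mod_cast h)
    have := (Nat.prime_dvd_prime_iff_eq Fact.out Nat.prime_two).mp h'
    omega
  have h4 : (4 : ZMod q) ≠ 0 := by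
    rw [show (4 : ZMod q) = 2 * 2 by norm_num]
    exact mul_ne_zero h2 h2
  have hg : gaussSum (legendreChar q K) ψ ≠ 0 := by
    intro h0
    have h := gaussSum_legendreChar_sq (K := K) hq hψ
    rw [h0, zero_mul, zero_eq_neg] at h
    exact Nat.cast_ne_zero.mpr (Fact.out : q.Prime).ne_zero h
  let c : ZMod q := -1 / (4 * b)
  have hc : c ≠ 0 := div_ne_zero (neg_ne_zero.mpr one_ne_zero) (mul_ne_zero h4 hb)
  let r : (ZMod q)ˣ := Units.mk0 (2 * c) (mul_ne_zero h2 hc)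
  have hε : ∃ ε : ℤˣ, legendreChar q K b * legendreChar q K r = ((ε : ℤ) : K) := by
    rcases legendreChar_eq_one_or (K := K) hb with h | h <;>
      rcases legendreChar_eq_one_or (K := K) r.ne_zero with h' | h' <;> rw [h, h']
    · exact ⟨1, by simp⟩
    · exact ⟨-1, by simp⟩
    · exact ⟨-1, by simp⟩
    · exact ⟨1, by simp⟩
  obtain ⟨ε, hε⟩ := hε
  refine ⟨ε, r, c, fun a => ?_⟩
  rw [weilOperator_mul_weilOperator hq hσ, weilOperator_apply, map_mul, map_inv₀,
    map_gaussSum_of_sq hσ, ← hε, map_sum]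
  simp only [sum_addChar_quadratic (by omega : q ≠ 2) hψ hb, Finset.mul_sum]
  refine (Fintype.sum_equiv (Equiv.mulLeft r) _ _ fun y => ?_).symm
  simp only [Equiv.coe_mulLeft]
  rw [map_mul (σ (r ^ 2)), map_mul (σ (r ^ 2)),
    map_legendreChar, hσ, map_mul (σ (y ^ 2)), map_mul (σ (r ^ 2)), hσ, hσ, Units.val_mul, map_mul (legendreChar q K), mul_pow,
    map_mul σ, AlgEquiv.mul_apply,
    show -(1 + (r : ZMod q) * y) ^ 2 / (4 * b) = c + ((r ^ 2 : (ZMod q)ˣ) : ZMod q) * y +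
      ((r ^ 2 : (ZMod q)ˣ) : ZMod q) * (((y ^ 2 : (ZMod q)ˣ) : ZMod q) * c) by
        simp only [r, c, Units.val_mk0, Units.val_pow_eq_pow_val]
        field_simp
        ring,
    AddChar.map_add_eq_mul, AddChar.map_add_eq_mul]
  field_simp

end WeilOperator

/-- The units whose left multiplication, and that of their inverse, preserves `S`. -/
def unitsPreserving {M : Type*} [Monoid M] (S : Set M) : Subgroup Mˣ where
  carrier := {h | (∀ s ∈ S, (h : M) * s ∈ S) ∧ ∀ s ∈ S, ((h⁻¹ : Mˣ) : M) * s ∈ S}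
  one_mem' := by simp
  mul_mem' := by
    rintro a b ⟨ha, ha'⟩ ⟨hb, hb'⟩
    refine ⟨fun s hs => ?_, fun s hs => ?_⟩
    · rw [Units.val_mul, mul_assoc]
      exact ha _ (hb _ hs)
    · rw [_root_.mul_inv_rev, Units.val_mul, mul_assoc]
      exact hb' _ (ha' _ hs)
  inv_mem' := by
    rintro a ⟨ha, ha'⟩
    exact ⟨ha', by simpa using ha⟩

theorem mem_of_mem_unitsPreserving {M : Type*} [Monoid M] {S : Set M} (h1 : 1 ∈ S) {h : Mˣ}
    (hh : h ∈ unitsPreserving S) : (h : M) ∈ S := by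
  simpa using hh.1 1 h1

theorem finite_unitsPreserving {M : Type*} [Monoid M] {S : Set M} (hS : S.Finite) (h1 : 1 ∈ S) :
    Finite (unitsPreserving S) := by
  have : Finite S := hS
  refine Finite.of_injective
    (fun h : unitsPreserving S => (⟨_, mem_of_mem_unitsPreserving h1 h.2⟩ : S)) fun a b hab => ?_
  exact Subtype.ext (Units.ext (Subtype.ext_iff.mp hab))

theorem exists_mem_unitsPreserving {M : Type*} [Monoid M] {S : Set M} {a b : M} (hab : a * b = 1)
    (hba : b * a = 1) (ha : ∀ s ∈ S, a * s ∈ S) (hb : ∀ s ∈ S, b * s ∈ S) :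
    ∃ h ∈ unitsPreserving S, (h : M) = a :=
  ⟨⟨a, b, hab, hba⟩, ⟨ha, hb⟩, rfl⟩

section WeilGroup

variable {q : ℕ} [Fact q.Prime] {K : Type*} [Field K] [Algebra ℚ K]

/-- The operators `± ψ b ∘ σ (r ^ 2)`. -/
noncomputable def monomialOperator (ψ : AddChar (ZMod q) K) (σ : (ZMod q)ˣ →* (K ≃ₐ[ℚ] K))
    (ε : ℤˣ) (b : ZMod q) (r : (ZMod q)ˣ) : Module.End ℚ K :=
  LinearMap.mulLeft ℚ (((ε : ℤ) : K) * ψ b) ∘ₗ (σ (r ^ 2)).toLinearMap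

/-- The operators `± ψ b ∘ σ (r ^ 2)` and `± ψ b ∘ σ (r ^ 2) ∘ w ∘ ψ c`, where `w` is the Weil
operator. -/
def weilSet (ψ : AddChar (ZMod q) K) (σ : (ZMod q)ˣ →* (K ≃ₐ[ℚ] K)) : Set (Module.End ℚ K) :=
  (Set.range fun x : ℤˣ × ZMod q × (ZMod q)ˣ => monomialOperator ψ σ x.1 x.2.1 x.2.2) ∪
    Set.range fun x : (ℤˣ × ZMod q × (ZMod q)ˣ) × ZMod q =>
      monomialOperator ψ σ x.1.1 x.1.2.1 x.1.2.2 *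
        (weilOperator ψ σ * LinearMap.mulLeft ℚ (ψ x.2))

variable {ψ : AddChar (ZMod q) K} {σ : (ZMod q)ˣ →* (K ≃ₐ[ℚ] K)}

theorem monomialOperator_apply (ε : ℤˣ) (b : ZMod q) (r : (ZMod q)ˣ) (a : K) :
    monomialOperator ψ σ ε b r a = ((ε : ℤ) : K) * (ψ b * σ (r ^ 2) a) := by
  simp [monomialOperator]

theorem monomialOperator_one : monomialOperator ψ σ 1 0 1 = 1 := by
  ext a
  simp [monomialOperator_apply]

theorem monomialOperator_mul (hσ : ∀ t x, σ t (ψ x) = ψ (t * x)) (ε ε' : ℤˣ) (b b' : ZMod q)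
    (r r' : (ZMod q)ˣ) :
    monomialOperator ψ σ ε b r * monomialOperator ψ σ ε' b' r' =
      monomialOperator ψ σ (ε * ε') (b + (r ^ 2 : (ZMod q)ˣ) * b') (r * r') := by
  ext a
  rw [Module.End.mul_apply, monomialOperator_apply, monomialOperator_apply, monomialOperator_apply,
    map_mul (σ (r ^ 2)), map_mul (σ (r ^ 2)), map_intCast, hσ, mul_pow, map_mul σ,
    AlgEquiv.mul_apply, AddChar.map_add_eq_mul, Units.val_mul, Int.cast_mul]
  ring

theorem finite_weilSet : (weilSet ψ σ).Finite :=
  (Set.finite_range _).union (Set.finite_range _)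

theorem monomialOperator_mem_weilSet (ε : ℤˣ) (b : ZMod q) (r : (ZMod q)ˣ) :
    monomialOperator ψ σ ε b r ∈ weilSet ψ σ :=
  Or.inl ⟨(ε, b, r), rfl⟩

theorem monomialOperator_mul_mem_weilSet (hσ : ∀ t x, σ t (ψ x) = ψ (t * x)) (ε : ℤˣ) (b : ZMod q)
    (r : (ZMod q)ˣ) : ∀ s ∈ weilSet ψ σ, monomialOperator ψ σ ε b r * s ∈ weilSet ψ σ := by
  rintro _ (⟨⟨ε', b', r'⟩, rfl⟩ | ⟨⟨⟨ε', b', r'⟩, c⟩, rfl⟩)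
  · dsimp only
    rw [monomialOperator_mul hσ]
    exact monomialOperator_mem_weilSet _ _ _
  · dsimp only
    rw [← mul_assoc, monomialOperator_mul hσ]
    exact Or.inr ⟨((_, _, _), c), rfl⟩

theorem weilOperator_mul_monomialOperator (hσ : ∀ t x, σ t (ψ x) = ψ (t * x)) (ε : ℤˣ)
    (b : ZMod q) (r : (ZMod q)ˣ) :
    weilOperator ψ σ * monomialOperator ψ σ ε b r = monomialOperator ψ σ ε 0 r⁻¹ *
      (weilOperator ψ σ * LinearMap.mulLeft ℚ (ψ (((r ^ 2)⁻¹ : (ZMod q)ˣ) * b))) := by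
  ext a
  have h := map_weilOperator (ψ := ψ) (σ := σ) hσ r⁻¹ (ψ (((r ^ 2)⁻¹ : (ZMod q)ˣ) * b) * a)
  rw [inv_pow, inv_inv, map_mul (σ (r ^ 2)), hσ, Units.mul_inv_cancel_left] at h
  simp only [Module.End.mul_apply, LinearMap.mulLeft_apply, monomialOperator_apply, inv_pow, h,
    AddChar.map_zero_eq_one, one_mul]
  rw [← zsmul_eq_mul, ← zsmul_eq_mul, map_zsmul]

theorem weilOperator_mul_mem_weilSet (hq : q % 4 = 3) (hψ : ψ.IsPrimitive)
    (hσ : ∀ t x, σ t (ψ x) = ψ (t * x)) :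
    ∀ s ∈ weilSet ψ σ, weilOperator ψ σ * s ∈ weilSet ψ σ := by
  rintro _ (⟨⟨ε, b, r⟩, rfl⟩ | ⟨⟨⟨ε, b, r⟩, c⟩, rfl⟩)
  · exact Or.inr ⟨((ε, 0, r⁻¹), _), (weilOperator_mul_monomialOperator hσ ε b r).symm⟩
  · dsimp only
    rw [← mul_assoc, weilOperator_mul_monomialOperator hσ, mul_assoc]
    refine monomialOperator_mul_mem_weilSet hσ _ _ _ _ ?_
    rcases eq_or_ne (((r ^ 2)⁻¹ : (ZMod q)ˣ) * b) 0 with h0 | h0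
    · convert monomialOperator_mem_weilSet 1 c 1 using 1
      ext a
      rw [h0]
      simp [weilOperator_weilOperator hq hψ hσ, monomialOperator_apply]
    · obtain ⟨ε', r', d, h⟩ := weilOperator_mul_weilOperator_of_ne_zero hq hψ hσ h0
      refine Or.inr ⟨((ε', d, r'), d + c), ?_⟩
      ext a
      simp only [Module.End.mul_apply, LinearMap.mulLeft_apply, h, monomialOperator_apply,
        AddChar.map_add_eq_mul, mul_assoc]

theorem gaussSum_comm_of_mem_weilSet (hσ : ∀ t x, σ t (ψ x) = ψ (t * x)) :
    ∀ s ∈ weilSet ψ σ, ∀ a, s (gaussSum (legendreChar q K) ψ * a) =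
      gaussSum (legendreChar q K) ψ * s a := by
  have hm : ∀ ε b r a, monomialOperator ψ σ ε b r (gaussSum (legendreChar q K) ψ * a) =
      gaussSum (legendreChar q K) ψ * monomialOperator ψ σ ε b r a := fun ε b r a => by
    rw [monomialOperator_apply, monomialOperator_apply, map_mul, map_gaussSum_of_sq hσ]
    ring
  rintro _ (⟨⟨ε, b, r⟩, rfl⟩ | ⟨⟨⟨ε, b, r⟩, c⟩, rfl⟩) a
  · exact hm _ _ _ _
  · dsimp only
    rw [Module.End.mul_apply, Module.End.mul_apply, Module.End.mul_apply, Module.End.mul_apply,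
      LinearMap.mulLeft_apply, LinearMap.mulLeft_apply, mul_left_comm, weilOperator_gaussSum_mul hσ,
      hm]

/-- The Weil operator is not one of the operators `± ψ b ∘ σ (r ^ 2)`. -/
theorem weilOperator_ne_monomialOperator (hq : q % 4 = 3) (hq5 : 5 < q) (hψ : ψ.IsPrimitive)
    (hσ : ∀ t x, σ t (ψ x) = ψ (t * x)) (ε : ℤˣ) (b : ZMod q) (r : (ZMod q)ˣ) :
    weilOperator ψ σ ≠ monomialOperator ψ σ ε b r := by
  intro heq
  have hprime : q.Prime := Fact.out
  have hne : ∀ k : ℕ, ¬ q ∣ k → (k : ZMod q) ≠ 0 := fun k hk h =>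
    hk ((ZMod.natCast_eq_zero_iff k q).mp h)
  have h2 : (2 : ZMod q) ≠ 0 := by
    exact_mod_cast hne 2 (Nat.not_dvd_of_pos_of_lt (by norm_num) (by omega))
  have h4 : (4 : ZMod q) ≠ 0 := by
    rw [show (4 : ZMod q) = 2 * 2 by norm_num]
    exact mul_ne_zero h2 h2
  let u : (ZMod q)ˣ := Units.mk0 2 h2
  have hε : ((ε : ℤ) : K) ≠ 0 := by
    rcases Int.units_eq_one_or ε with rfl | rfl <;> simp
  have h := weilOperator_mul_monomialOperator (ψ := ψ) hσ 1 0 u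
  have h' : monomialOperator ψ σ ε b (r * u) =
      monomialOperator ψ σ ε ((u⁻¹ ^ 2 : (ZMod q)ˣ) * b) (u⁻¹ * r) := by
    have h1 : LinearMap.mulLeft ℚ (ψ (((u ^ 2)⁻¹ : (ZMod q)ˣ) * 0)) = 1 := by
      ext a
      simp
    rw [h1, mul_one, heq, monomialOperator_mul hσ, monomialOperator_mul hσ] at h
    simpa using h
  have hat : ∀ x, ψ (b + (r ^ 2 : (ZMod q)ˣ) * 4 * x) = ψ (b / 4 + (r ^ 2 : (ZMod q)ˣ) / 4 * x) := by
    intro x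
    have := LinearMap.congr_fun h' (ψ x)
    rw [monomialOperator_apply, monomialOperator_apply, mul_right_inj' hε, hσ, hσ,
      ← AddChar.map_add_eq_mul, ← AddChar.map_add_eq_mul] at this
    convert this using 2 <;> push_cast <;> simp only [u, Units.val_mk0] <;> field_simp <;>
      norm_num <;> field_simp
  have h0 := hψ.injective_zmod (hat 0)
  have h1 := hψ.injective_zmod (hat 1)
  have hr := r.ne_zero
  have h15 : ((15 : ℕ) : ZMod q) = 0 := by
    rw [mul_zero, mul_zero, add_zero, add_zero] at h0
    rw [mul_one, mul_one, ← h0, add_right_inj] at h1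
    push_cast at h1 ⊢
    field_simp at h1
    linear_combination h1
  have hdvd := (ZMod.natCast_eq_zero_iff 15 q).mp h15
  rw [show 15 = 3 * 5 by norm_num, hprime.dvd_mul] at hdvd
  rcases hdvd with h | h
  · exact absurd (Nat.le_of_dvd (by norm_num) h) (by omega)
  · exact absurd (Nat.le_of_dvd (by norm_num) h) (by omega)

end WeilGroup

section GaloisSemilinear

open Module

variable {V : Type*} [AddCommGroup V] [Module ℚ V] {q : ℕ} {K : Type*} [Field K] [Algebra ℚ K]

/-- `u` is semilinear over the action `f` of `K`, with respect to the field automorphism `σ t`. -/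
def IsGaloisSemilinear (f : K →ₐ[ℚ] End ℚ V) (σ : (ZMod q)ˣ →* (K ≃ₐ[ℚ] K)) (u : End ℚ V)
    (t : (ZMod q)ˣ) : Prop :=
  ∀ a, u * f a = f (σ t a) * u

variable {f : K →ₐ[ℚ] End ℚ V} {σ : (ZMod q)ˣ →* (K ≃ₐ[ℚ] K)} {u u' : End ℚ V} {t t' : (ZMod q)ˣ}

theorem IsGaloisSemilinear.apply (h : IsGaloisSemilinear f σ u t) (a : K) (v : V) :
    u (f a v) = f (σ t a) (u v) :=
  LinearMap.congr_fun (h a) v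

theorem IsGaloisSemilinear.mul (h : IsGaloisSemilinear f σ u t) (h' : IsGaloisSemilinear f σ u' t') :
    IsGaloisSemilinear f σ (u * u') (t * t') := fun a => by
  rw [mul_assoc, h', ← mul_assoc, h, mul_assoc, map_mul, AlgEquiv.mul_apply]

theorem IsGaloisSemilinear.one : IsGaloisSemilinear f σ 1 1 := fun a => by simp

theorem IsGaloisSemilinear.pow (h : IsGaloisSemilinear f σ u t) (n : ℕ) :
    IsGaloisSemilinear f σ (u ^ n) (t ^ n) := by
  induction n with
  | zero => simpa using IsGaloisSemilinear.one
  | succ n ih =>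
    rw [pow_succ, pow_succ]
    exact ih.mul h

/-- Semilinearity can be tested on a primitive root of unity. -/
theorem isGaloisSemilinear_of_primitiveRoot [NeZero q] [IsCyclotomicExtension {q} ℚ K] {ζ : K}
    (hζ : IsPrimitiveRoot ζ q) (h : u * f ζ = f (σ t ζ) * u) : IsGaloisSemilinear f σ u t := by
  intro a
  have ha : a ∈ Algebra.adjoin ℚ {ζ} :=
    IsCyclotomicExtension.adjoin_primitive_root_eq_top (A := ℚ) hζ ▸ Algebra.mem_top
  induction ha using Algebra.adjoin_induction with
  | mem x hx => rw [Set.mem_singleton_iff.mp hx, h]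
  | algebraMap r => rw [AlgEquiv.commutes, AlgHom.commutes, Algebra.commutes]
  | add x y _ _ hx hy => rw [map_add, map_add, map_add, mul_add, add_mul, hx, hy]
  | mul x y _ _ hx hy =>
    rw [map_mul, map_mul, map_mul, ← mul_assoc, hx, mul_assoc, hy, mul_assoc]

/-- If `V` has dimension one over `K`, a nonzero vector identifies `K` with `V`. -/
theorem exists_linearEquiv_apply [FiniteDimensional ℚ V] [FiniteDimensional ℚ K]
    (hdim : finrank ℚ K = finrank ℚ V) (f : K →ₐ[ℚ] End ℚ V) {v : V} (hv : v ≠ 0) :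
    ∃ e : K ≃ₗ[ℚ] V, ∀ x, e x = f x v := by
  let l : K →ₗ[ℚ] V := (LinearMap.applyₗ v) ∘ₗ f.toLinearMap
  have hl : ∀ x, l x = f x v := fun x => rfl
  have hinj : Function.Injective l := by
    rw [injective_iff_map_eq_zero]
    intro x hx
    by_contra hne
    apply hv
    have : f (x⁻¹ * x) v = 0 := by
      rw [map_mul, Module.End.mul_apply, ← hl, hx, map_zero]
    rwa [inv_mul_cancel₀ hne, map_one, Module.End.one_apply] at this
  exact ⟨l.linearEquivOfInjective hinj hdim, fun x => by
    rw [LinearMap.linearEquivOfInjective_apply, hl]⟩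

/-- If `V` has dimension one over `K`, the `K`-linear endomorphisms are scalars. -/
theorem IsGaloisSemilinear.exists_eq [FiniteDimensional ℚ V] [FiniteDimensional ℚ K] [Nontrivial V]
    (hdim : finrank ℚ K = finrank ℚ V) (h : IsGaloisSemilinear f σ u 1) : ∃ a, u = f a := by
  obtain ⟨v, hv⟩ := exists_ne (0 : V)
  obtain ⟨e, he⟩ := exists_linearEquiv_apply hdim f hv
  refine ⟨e.symm (u v), LinearMap.ext fun w => ?_⟩
  obtain ⟨x, rfl⟩ := e.surjective w
  rw [he, h.apply, map_one, AlgEquiv.one_apply, ← Module.End.mul_apply (f (e.symm _)), ← map_mul,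
    mul_comm, map_mul, Module.End.mul_apply, ← he, e.apply_symm_apply]

/-- An element of finite order of the group algebra generated by `ζ_q` is `± ζ_q ^ r`. -/
theorem exists_eq_unit_mul_pow [NeZero q] [IsCyclotomicExtension {q} ℚ K] (hq : Odd q) {ζ : K}
    (hζ : IsPrimitiveRoot ζ q) {b : K} {n : ℕ} (hn : 0 < n) (hb : b ^ n = 1) :
    ∃ (ε : ℤˣ) (r : ℕ), b = ((ε : ℤ) : K) * ζ ^ r := by
  have : CharZero K := algebraRat.charZero K
  obtain rfl : ‹Algebra ℚ K› = DivisionRing.toRatAlgebra := Subsingleton.elim _ _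
  have : NumberField K := IsCyclotomicExtension.numberField {q} ℚ K
  obtain ⟨r, -, h | h⟩ := hζ.exists_pow_or_neg_mul_pow_of_isOfFinOrder hq
    (isOfFinOrder_iff_pow_eq_one.mpr ⟨n, hn, hb⟩)
  · exact ⟨1, r, by simp [h]⟩
  · exact ⟨-1, r, by simp [h]⟩

/-- A power of a semilinear map over complex conjugation cannot be a negative scalar. -/
theorem IsGaloisSemilinear.sq_eq_one_of_neg_one [NeZero q] [IsCyclotomicExtension {q} ℚ K]
    [FiniteDimensional ℚ V] [FiniteDimensional ℚ K] [Nontrivial V]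
    (hdim : finrank ℚ K = finrank ℚ V) {ζ : K} (hζ : IsPrimitiveRoot ζ q)
    (hσζ : σ (-1) ζ = ζ⁻¹) (h : IsGaloisSemilinear f σ u (-1)) {n : ℕ} (hn : 0 < n)
    (hu : u ^ n = 1) : u * u = 1 := by
  obtain ⟨v, hv⟩ := exists_ne (0 : V)
  obtain ⟨e, he⟩ := exists_linearEquiv_apply hdim f hv
  have hfinj : Function.Injective f := f.toRingHom.injective
  let a := e.symm (u v)
  have hav : u v = f a v := by rw [← he, e.apply_symm_apply]
  have hu2 : u * u = f (σ (-1) a * a) := by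
    obtain ⟨b, hb⟩ := IsGaloisSemilinear.exists_eq (f := f) (σ := σ) (u := u * u) hdim
      (by simpa using h.mul h)
    have hbv : e b = e (σ (-1) a * a) := by
      rw [he, ← hb, he, Module.End.mul_apply, hav, h.apply, hav, map_mul, Module.End.mul_apply]
    rw [hb, e.injective hbv]
  have : NumberField K := IsCyclotomicExtension.numberField {q} ℚ K
  obtain ⟨φ⟩ : Nonempty (K →+* ℂ) := inferInstance
  have hconj : ∀ x, φ (σ (-1) x) = starRingEnd ℂ (φ x) := by
    intro x
    have hx : x ∈ Algebra.adjoin ℚ {ζ} :=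
      IsCyclotomicExtension.adjoin_primitive_root_eq_top (A := ℚ) hζ ▸ Algebra.mem_top
    induction hx using Algebra.adjoin_induction with
    | mem x hx =>
      rw [Set.mem_singleton_iff.mp hx, hσζ, map_inv₀]
      refine Complex.inv_eq_conj ?_
      exact Complex.norm_eq_one_of_pow_eq_one (n := q) (by rw [← map_pow, hζ.pow_eq_one, map_one])
        (NeZero.ne q)
    | algebraMap r => simp
    | add x y _ _ hx hy => rw [map_add, map_add, map_add, map_add, hx, hy]
    | mul x y _ _ hx hy => rw [map_mul, map_mul, map_mul, map_mul, hx, hy]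
  have hone : (σ (-1) a * a) ^ n = 1 := by
    apply hfinj
    rw [map_pow, ← hu2, map_one, ← pow_two, ← pow_mul, mul_comm, pow_mul, hu, one_pow]
  have hnorm : φ (σ (-1) a * a) = ((Complex.normSq (φ a) : ℝ) : ℂ) := by
    rw [map_mul, hconj, mul_comm, Complex.mul_conj]
  have hsq : Complex.normSq (φ a) = 1 := by
    have h1 := congrArg φ hone
    rw [map_pow, hnorm, map_one] at h1
    exact (pow_eq_one_iff_of_nonneg (Complex.normSq_nonneg _) hn.ne').mp (by exact_mod_cast h1)
  have h1 : σ (-1) a * a = 1 := φ.injective (by rw [hnorm, hsq, map_one, Complex.ofReal_one])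
  rw [hu2, h1, map_one]

end GaloisSemilinear

section SophieGermain

open Module

variable {V : Type*} [AddCommGroup V] [Module ℚ V] {G : Type*} [Group G] {q : ℕ} [Fact q.Prime]
  {K : Type*} [Field K] [Algebra ℚ K]

/-- The additive characters of `ℤ/q` and the Galois action on `ℚ(ζ_q)`. -/
theorem exists_addChar_galois [IsCyclotomicExtension {q} ℚ K] {ζ : K} (hζ : IsPrimitiveRoot ζ q) :
    ∃ (ψ : AddChar (ZMod q) K) (σ : (ZMod q)ˣ →* (K ≃ₐ[ℚ] K)), ψ.IsPrimitive ∧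
      (∀ t x, σ t (ψ x) = ψ (t * x)) ∧ ∀ n : ℕ, ψ n = ζ ^ n := by
  let E := IsCyclotomicExtension.autEquivPow K
    (Polynomial.cyclotomic.irreducible_rat (NeZero.pos q))
  refine ⟨AddChar.zmodChar q hζ.pow_eq_one, E.symm.toMonoidHom,
    AddChar.zmodChar_primitive_of_primitive_root q hζ, fun t x => ?_,
    AddChar.zmodChar_apply' hζ.pow_eq_one⟩
  obtain ⟨s, rfl⟩ := E.surjective t
  have hs : s ζ = ζ ^ (E s : ZMod q).val := by
    obtain ⟨a, -, ha⟩ := (IsCyclotomicExtension.zeta_spec q ℚ K).eq_pow_of_pow_eq_one hζ.pow_eq_one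
    rw [← ha, map_pow, pow_right_comm, IsCyclotomicExtension.autEquivPow_apply,
      OneHom.toFun_eq_coe, MonoidHom.toOneHom_coe, IsPrimitiveRoot.autToPow_spec]
  have hx : AddChar.zmodChar q hζ.pow_eq_one (E s * x) =
      AddChar.zmodChar q hζ.pow_eq_one x ^ (E s : ZMod q).val := by
    rw [← AddChar.map_nsmul_eq_pow, nsmul_eq_mul, ZMod.natCast_zmod_val]
  rw [hx, MulEquiv.toMonoidHom_eq_coe, MonoidHom.coe_coe, E.symm_apply_apply,
    AddChar.zmodChar_apply, map_pow, hs, pow_right_comm]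

variable {ψ : AddChar (ZMod q) K} {σ : (ZMod q)ˣ →* (K ≃ₐ[ℚ] K)} {f : K →ₐ[ℚ] End ℚ V}
  {ρ : Representation ℚ G V} {ω : LinearMap.BilinForm ℚ V} {p : ℕ} {ζ : K}

/-- Elements normalizing a cyclic group generated by a primitive root of unity act
semilinearly. -/
theorem exists_isGaloisSemilinear_of_normal [Finite G] [Nontrivial V] [IsCyclotomicExtension {q} ℚ K]
    (hζ : IsPrimitiveRoot ζ q) (hσ : ∀ t x, σ t (ψ x) = ψ (t * x))
    (hψζ : ∀ n : ℕ, ψ n = ζ ^ n) {c : G} (hc : f ζ = ρ c) (hnormal : (Subgroup.zpowers c).Normal)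
    (g : G) : ∃ t, IsGaloisSemilinear f σ (ρ g) t := by
  have hmem : g * c * g⁻¹ ∈ Subgroup.zpowers c := hnormal.conj_mem c (Subgroup.mem_zpowers c) g
  rw [← mem_powers_iff_mem_zpowers] at hmem
  obtain ⟨k, hk⟩ := hmem
  have hgc : ρ g * f ζ = f (ζ ^ k) * ρ g := by
    rw [map_pow, hc, ← map_pow, ← map_mul, ← map_mul, show c ^ k = g * c * g⁻¹ from hk,
      inv_mul_cancel_right]
  have hk0 : (k : ZMod q) ≠ 0 := by
    intro h0
    rw [ZMod.natCast_eq_zero_iff] at h0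
    rw [(hζ.pow_eq_one_iff_dvd k).mpr h0, map_one, one_mul] at hgc
    have h1 : ρ g * f ζ = ρ g * 1 := by rw [hgc, mul_one]
    have h2 : f ζ = f 1 := by
      rw [map_one]
      exact (isUnit_representation ρ g).mul_left_cancel h1
    exact hζ.ne_one (Fact.out : q.Prime).one_lt (f.toRingHom.injective h2)
  refine ⟨Units.mk0 _ hk0, isGaloisSemilinear_of_primitiveRoot hζ ?_⟩
  have h1 := hσ (Units.mk0 _ hk0) 1
  rw [← Nat.cast_one, hψζ, pow_one, Nat.cast_one, mul_one, Units.val_mk0, hψζ] at h1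
  rw [h1, hgc]

/-- The semilinearity type of an isometry is a square when `q ≡ 3 mod 4`. -/
theorem exists_isGaloisSemilinear_sq [Finite G] [FiniteDimensional ℚ V] [FiniteDimensional ℚ K]
    [IsCyclotomicExtension {q} ℚ K]
    (hω : IsSymplecticAction ρ ω) (hp : Odd p) (hqp : q = 2 * p + 1)
    (hV : finrank ℚ V = 2 * p) (hdim : finrank ℚ K = finrank ℚ V)
    (hζ : IsPrimitiveRoot ζ q) (hσ : ∀ t x, σ t (ψ x) = ψ (t * x))
    (hψζ : ∀ n : ℕ, ψ n = ζ ^ n) {g : G} {t : (ZMod q)ˣ} (h : IsGaloisSemilinear f σ (ρ g) t) :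
    ∃ r : (ZMod q)ˣ, t = r ^ 2 := by
  by_contra hns
  have hp0 : 0 < p := hp.pos
  have hnontriv : Nontrivial V := nontrivial_of_finrank_pos (R := ℚ) (by omega)
  have htp : t ^ p = -1 := by
    have hq2 : q / 2 = p := by omega
    rcases ZMod.pow_div_two_eq_neg_one_or_one q t.ne_zero with h1 | h1
    · obtain ⟨r, hr⟩ := (ZMod.euler_criterion_units q t).mpr (Units.ext (by simpa using h1))
      exact absurd ⟨r, hr.symm⟩ hns
    · exact Units.ext (by simpa [hq2] using h1)
  have hu := h.pow p
  rw [htp] at hu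
  have hσζ : σ (-1) ζ = ζ⁻¹ := by
    have h1 := hσ (-1) 1
    rw [← Nat.cast_one, hψζ, pow_one, Nat.cast_one, mul_one, Units.val_neg, Units.val_one,
      AddChar.map_neg_eq_inv, ← Nat.cast_one, hψζ, pow_one] at h1
    exact h1
  have hfin : (ρ g ^ p) ^ Nat.card G = 1 := by
    rw [← map_pow, ← map_pow, pow_card_eq_one', map_one]
  have hsq := hu.sq_eq_one_of_neg_one hdim hζ hσζ Nat.card_pos hfin
  rw [← map_pow] at hsq hu
  refine false_of_anticommuting_involution hp hV ω hω.alt hω.nondegenerate hsq (hω.map_eq _)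
    (d := f (ζ - ζ⁻¹)) ?_ ?_
  · have hne : ζ - ζ⁻¹ ≠ 0 := by
      intro h0
      rw [sub_eq_zero, ← mul_eq_one_iff_eq_inv₀ (hζ.ne_zero (NeZero.ne q)), ← pow_two] at h0
      have := Nat.le_of_dvd (by norm_num) ((hζ.pow_eq_one_iff_dvd 2).mp h0)
      omega
    have hunit := (IsUnit.mk0 _ hne).map f
    exact ((Module.End.isUnit_iff _).mp hunit).injective
  · rw [hu, map_sub, map_inv₀, hσζ, inv_inv, ← neg_mul, ← map_neg, neg_sub]

/-- A group of semilinear maps of odd semilinearity type has a common eigenvector. -/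
theorem exists_common_eigenvector [Finite G] [FiniteDimensional ℚ V] [FiniteDimensional ℚ K]
    [Nontrivial V] [IsCyclotomicExtension {q} ℚ K]
    (hp : p.Prime) (hpodd : Odd p) (hqp : q = 2 * p + 1) (hdim : finrank ℚ K = finrank ℚ V)
    (hζ : IsPrimitiveRoot ζ q) (hψ : ψ.IsPrimitive) (hσ : ∀ t x, σ t (ψ x) = ψ (t * x))
    (hψζ : ∀ n : ℕ, ψ n = ζ ^ n)
    (hR : ∀ g, ∃ r : (ZMod q)ˣ, IsGaloisSemilinear f σ (ρ g) (r ^ 2)) :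
    ∃ v₀ : V, v₀ ≠ 0 ∧ ∀ g, ∃ (ε : ℤˣ) (b : ZMod q), ρ g v₀ = f (((ε : ℤ) : K) * ψ b) v₀ := by
  have hqodd : Odd q := ⟨p, hqp⟩
  have htorsion : ∀ g, IsGaloisSemilinear f σ (ρ g) 1 →
      ∃ (ε : ℤˣ) (b : ZMod q), ρ g = f (((ε : ℤ) : K) * ψ b) := by
    intro g hg
    obtain ⟨a, ha⟩ := hg.exists_eq hdim
    obtain ⟨ε, r, rfl⟩ := exists_eq_unit_mul_pow hqodd hζ (b := a) (Nat.card_pos (α := G)) (by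
      apply f.toRingHom.injective
      change f _ = f _
      rw [map_pow, ← ha, ← map_pow, pow_card_eq_one', map_one, map_one])
    exact ⟨ε, r, by rw [ha, hψζ]⟩
  by_cases hall : ∀ g, ∀ r : (ZMod q)ˣ, IsGaloisSemilinear f σ (ρ g) (r ^ 2) → r ^ 2 = 1
  · obtain ⟨v, hv⟩ := exists_ne (0 : V)
    refine ⟨v, hv, fun g => ?_⟩
    obtain ⟨r, hr⟩ := hR g
    obtain ⟨ε, b, h⟩ := htorsion g (hall g r hr ▸ hr)
    exact ⟨ε, b, by rw [h]⟩
  push Not at hall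
  obtain ⟨g₀, r₀, hu, hne⟩ := hall
  have hsqp : ∀ r : (ZMod q)ˣ, (r ^ 2) ^ p = 1 := fun r => by
    rw [← pow_mul, show 2 * p = q - 1 by omega]
    exact ZMod.units_pow_card_sub_one_eq_one q r
  have : Fact p.Prime := ⟨hp⟩
  have hprim : IsPrimitiveRoot (r₀ ^ 2) p :=
    orderOf_eq_prime (hsqp r₀) hne ▸ IsPrimitiveRoot.orderOf _
  set t := r₀ ^ 2
  have hup := hu.pow p
  rw [hsqp r₀, ← map_pow] at hup
  obtain ⟨ε, b, hεb⟩ := htorsion _ hup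
  rw [map_pow] at hεb
  have hb : b = 0 := by
    have h1 : f (σ t (((ε : ℤ) : K) * ψ b)) * ρ g₀ = f (((ε : ℤ) : K) * ψ b) * ρ g₀ := by
      rw [← hu, ← hεb, ← pow_succ, ← pow_succ']
    have h2 := f.toRingHom.injective ((isUnit_representation ρ g₀).mul_right_cancel h1)
    rw [map_mul, map_intCast, hσ] at h2
    have hε : ((ε : ℤ) : K) ≠ 0 := by
      rcases Int.units_eq_one_or ε with rfl | rfl <;> simp
    have h3 := hψ.injective_zmod (mul_left_cancel₀ hε h2)
    by_contra hb0
    exact hne (Units.ext (by simpa [hb0] using h3))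
  rw [hb, AddChar.map_zero_eq_one, mul_one, map_intCast] at hεb
  let u : End ℚ V := ((ε : ℤ) : End ℚ V) * ρ g₀
  have hεcomm : ∀ x : End ℚ V, Commute ((ε : ℤ) : End ℚ V) x := fun x => Int.cast_commute _ _
  have hεsq : ((ε : ℤ) : End ℚ V) * ((ε : ℤ) : End ℚ V) = 1 := by
    rcases Int.units_eq_one_or ε with rfl | rfl <;> simp
  have hupow : ∀ i, u ^ i = ((ε : ℤ) : End ℚ V) ^ i * ρ g₀ ^ i := fun i => (hεcomm _).mul_pow i
  have hup1 : u ^ p = 1 := by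
    rw [hupow, hεb, ← pow_succ]
    obtain ⟨m, hm⟩ := hpodd.add_one
    rw [hm, ← two_mul, pow_mul, pow_two, hεsq, one_pow]
  have husemi : ∀ i, IsGaloisSemilinear f σ (u ^ i) (t ^ i) := by
    have : IsGaloisSemilinear f σ u t := fun a => by
      rw [mul_assoc, hu, ← mul_assoc, (hεcomm _).eq, mul_assoc]
    exact fun i => this.pow i
  let P : End ℚ V := ∑ i ∈ Finset.range p, u ^ i
  have hP : P ≠ 0 := by
    intro hP0
    obtain ⟨v, hv⟩ := exists_ne (0 : V)
    obtain ⟨e, he⟩ := exists_linearEquiv_apply hdim f hv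
    have hsum : ∀ x, ∑ i : Fin p, e.symm ((u ^ (i : ℕ)) v) * σ (t ^ (i : ℕ)) x = 0 := by
      intro x
      apply e.injective
      rw [map_zero, he, map_sum, LinearMap.sum_apply]
      have h0 : P (f x v) = 0 := by rw [hP0, LinearMap.zero_apply]
      rw [← h0, LinearMap.sum_apply, Finset.sum_range]
      refine Finset.sum_congr rfl fun i _ => ?_
      rw [(husemi i).apply, mul_comm, map_mul, Module.End.mul_apply, ← he (e.symm _),
        e.apply_symm_apply]
    have hinj : Function.Injective fun i : Fin p => ((σ (t ^ (i : ℕ)) : K ≃ₐ[ℚ] K) : K →* K) := by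
      intro i j hij
      have h1 := DFunLike.congr_fun hij (ψ 1)
      have h2 : σ (t ^ (i : ℕ)) (ψ 1) = σ (t ^ (j : ℕ)) (ψ 1) := h1
      rw [hσ, hσ, mul_one, mul_one] at h2
      exact Fin.ext (hprim.pow_inj i.2 j.2 (Units.ext (hψ.injective_zmod h2)))
    have hli := (linearIndependent_monoidHom K K).comp _ hinj
    rw [Fintype.linearIndependent_iff] at hli
    have h0 := hli (fun i => e.symm ((u ^ (i : ℕ)) v)) (by
      ext x
      simpa using hsum x) ⟨0, hp.pos⟩
    simp only [pow_zero, Module.End.one_apply] at h0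
    exact hv ((LinearEquiv.map_eq_zero_iff _).mp h0)
  obtain ⟨w, hw⟩ : ∃ w, P w ≠ 0 := by
    by_contra! h
    exact hP (LinearMap.ext h)
  have huP : u * P = P := by
    have := mul_geom_sum u p
    rw [hup1, sub_self, sub_mul, one_mul, sub_eq_zero] at this
    exact this
  have hu0 : ∀ i, (u ^ i) (P w) = P w := by
    intro i
    induction i with
    | zero => simp
    | succ i ih =>
      rw [pow_succ, Module.End.mul_apply, ← Module.End.mul_apply u, huP, ih]
  refine ⟨P w, hw, fun g => ?_⟩
  obtain ⟨r, hr⟩ := hR g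
  obtain ⟨i, -, hi⟩ : ∃ i < p, t ^ i = (r ^ 2)⁻¹ := by
    have hprim' : IsPrimitiveRoot (t : ZMod q) p := IsPrimitiveRoot.coe_units_iff.mpr hprim
    obtain ⟨i, hip, hi⟩ := hprim'.eq_pow_of_pow_eq_one (ξ := (((r ^ 2)⁻¹ : (ZMod q)ˣ) : ZMod q)) (by
      rw [← Units.val_pow_eq_pow_val, inv_pow, hsqp, inv_one, Units.val_one])
    exact ⟨i, hip, Units.ext (by rw [Units.val_pow_eq_pow_val, hi])⟩
  have hg := hr.mul (hu.pow i)
  rw [hi, mul_inv_cancel, ← map_pow, ← map_mul] at hg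
  obtain ⟨ε', b', h'⟩ := htorsion _ hg
  refine ⟨ε ^ i * ε', b', ?_⟩
  have h1 : ρ g * u ^ i = ((ε : ℤ) : End ℚ V) ^ i * f (((ε' : ℤ) : K) * ψ b') := by
    rw [← h', hupow, ← mul_assoc, ← ((hεcomm (ρ g)).pow_left i).eq, mul_assoc, map_mul, map_pow]
  calc ρ g (P w) = (ρ g * u ^ i) (P w) := by rw [Module.End.mul_apply, hu0]
    _ = f ((((ε ^ i * ε' : ℤˣ) : ℤ) : K) * ψ b') (P w) := by
      rw [h1]
      push_cast
      rw [mul_assoc, map_mul _ (((ε : ℤ) : K) ^ i), map_pow, map_intCast]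

end SophieGermain

section WeilMaximal

open Module

variable {V : Type*} [AddCommGroup V] [Module ℚ V] {G : Type*} [Group G]

/-- The image of `ρ` contains every finite group of symplectic maps that contains it. -/
def IsMaximalSymplectic (ρ : Representation ℚ G V) : Prop :=
  ∀ H : Subgroup (End ℚ V)ˣ, Finite H →
    (∃ ω : LinearMap.BilinForm ℚ V, (∀ v w, ω v w = -ω w v) ∧ (∀ v, (∀ w, ω v w = 0) → v = 0) ∧
      ∀ h ∈ H, ∀ v w, ω ((h : End ℚ V) v) ((h : End ℚ V) w) = ω v w) →
    (∀ g, ∃ h ∈ H, (h : End ℚ V) = ρ g) → ∀ h ∈ H, ∃ g, ρ g = h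

variable {ρ : Representation ℚ G V} {ω : LinearMap.BilinForm ℚ V} {p : ℕ}

/-- The image of the group of invertible operators preserving the Weil set is not larger than
a maximal group of monomial operators. -/
theorem false_of_forall_eq_monomialOperator [FiniteDimensional ℚ V] {q : ℕ} [Fact q.Prime]
    {K : Type*} [Field K] [Algebra ℚ K] (hmax : IsMaximalSymplectic ρ) (hq : q % 4 = 3)
    (hq5 : 5 < q) {ψ : AddChar (ZMod q) K} {σ : (ZMod q)ˣ →* (K ≃ₐ[ℚ] K)} (hψ : ψ.IsPrimitive)
    (hσ : ∀ t x, σ t (ψ x) = ψ (t * x)) (e : K ≃ₗ[ℚ] V)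
    (hρ : ∀ g, ∃ ε b r, ρ g = e.conjRingEquiv (monomialOperator ψ σ ε b r)) : False := by
  have : CharZero K := algebraRat.charZero K
  have h1 : (1 : End ℚ K) ∈ weilSet ψ σ :=
    monomialOperator_one (ψ := ψ) (σ := σ) ▸ monomialOperator_mem_weilSet _ _ _
  let Φ : (End ℚ K)ˣ ≃* (End ℚ V)ˣ := Units.mapEquiv e.conjRingEquiv.toMulEquiv
  have hconj : ∀ (a : End ℚ K) x, e.conjRingEquiv a (e x) = e (a x) := fun a x => by simp
  let H := (unitsPreserving (weilSet ψ σ)).map Φ.toMonoidHom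
  have : Finite (unitsPreserving (weilSet ψ σ)) := finite_unitsPreserving finite_weilSet h1
  have hfin : Finite H :=
    ((Set.toFinite (unitsPreserving (weilSet ψ σ) : Set (End ℚ K)ˣ)).image Φ).to_subtype
  let g₀ := gaussSum (legendreChar q K) ψ
  have hform := exists_invariant_symplectic_of_commute H (n := (q : ℚ))
    (J := e.conjRingEquiv (LinearMap.mulLeft ℚ g₀))
    (by exact_mod_cast (Fact.out : q.Prime).pos) (fun v => by
      obtain ⟨x, rfl⟩ := e.surjective v
      rw [hconj, hconj, ← map_smul, ← map_neg, LinearMap.mulLeft_apply, LinearMap.mulLeft_apply,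
        ← mul_assoc, gaussSum_legendreChar_sq hq hψ, Algebra.smul_def, map_natCast, neg_mul]) (by
      rintro _ ⟨h, hh, rfl⟩ v
      obtain ⟨x, rfl⟩ := e.surjective v
      change e.conjRingEquiv h (e.conjRingEquiv _ _) = e.conjRingEquiv _ (e.conjRingEquiv h _)
      rw [hconj, hconj, hconj, hconj, LinearMap.mulLeft_apply, LinearMap.mulLeft_apply,
        gaussSum_comm_of_mem_weilSet hσ _ (mem_of_mem_unitsPreserving h1 hh)])
  have hmem : ∀ a b : End ℚ K, a * b = 1 → b * a = 1 → (∀ s ∈ weilSet ψ σ, a * s ∈ weilSet ψ σ) →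
      (∀ s ∈ weilSet ψ σ, b * s ∈ weilSet ψ σ) →
      ∃ h ∈ H, (h : End ℚ V) = e.conjRingEquiv a := by
    intro a b hab hba ha hb
    obtain ⟨h, hh, rfl⟩ := exists_mem_unitsPreserving hab hba ha hb
    exact ⟨Φ h, ⟨h, hh, rfl⟩, rfl⟩
  have hw := weilOperator_weilOperator hq hψ hσ
  obtain ⟨h, hh, hhw⟩ := hmem (weilOperator ψ σ) (weilOperator ψ σ) (LinearMap.ext hw)
    (LinearMap.ext hw) (weilOperator_mul_mem_weilSet hq hψ hσ)
    (weilOperator_mul_mem_weilSet hq hψ hσ)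
  obtain ⟨g, hg⟩ := hmax H hfin hform (fun g => by
    obtain ⟨ε, b, r, hg⟩ := hρ g
    obtain ⟨h, hh, heq⟩ := hmem (monomialOperator ψ σ ε b r)
      (monomialOperator ψ σ ε (-(((r ^ 2)⁻¹ : (ZMod q)ˣ) * b)) r⁻¹)
      (by
        rw [monomialOperator_mul hσ, Int.units_mul_self, mul_inv_cancel, mul_neg,
          Units.mul_inv_cancel_left, add_neg_cancel, monomialOperator_one])
      (by
        rw [monomialOperator_mul hσ, Int.units_mul_self, inv_mul_cancel, inv_pow,
          neg_add_cancel, monomialOperator_one])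
      (monomialOperator_mul_mem_weilSet hσ _ _ _) (monomialOperator_mul_mem_weilSet hσ _ _ _)
    exact ⟨h, hh, by rw [heq, hg]⟩) h hh
  obtain ⟨ε, b, r, hg'⟩ := hρ g
  refine weilOperator_ne_monomialOperator hq hq5 hψ hσ ε b r (e.conjRingEquiv.injective ?_)
  rw [← hhw, ← hg, hg']

/-- If `2 p + 1` is prime, a maximal finite symplectic group of degree `2 p` has no normal
subgroup generated by an element acting as a primitive `(2 p + 1)`-st root of unity. -/
theorem IsMaximalSymplectic.aeval_cyclotomic_ne_zero [Finite G] [FiniteDimensional ℚ V]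
    (hmax : IsMaximalSymplectic ρ) (hω : IsSymplecticAction ρ ω) (hp : p.Prime) (hp5 : 5 ≤ p)
    (hV : finrank ℚ V = 2 * p) (hq : (2 * p + 1).Prime) (c : G)
    (hc : (Subgroup.zpowers c).Normal) :
    Polynomial.aeval (ρ c) (Polynomial.cyclotomic (2 * p + 1) ℚ) ≠ 0 := by
  intro h0
  obtain ⟨q, hqp⟩ : ∃ q, q = 2 * p + 1 := ⟨_, rfl⟩
  rw [← hqp] at hq h0
  have : Fact q.Prime := ⟨hq⟩
  have hodd : Odd p := hp.odd_of_ne_two (by omega)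
  have hq4 : q % 4 = 3 := by
    obtain ⟨k, hk⟩ := hodd
    omega
  have : Nontrivial V := nontrivial_of_finrank_pos (R := ℚ) (by omega)
  obtain ⟨K, _, _, _, ζ, hζ, f, hf⟩ := exists_cyclotomic_action h0
  have : FiniteDimensional ℚ K := IsCyclotomicExtension.finiteDimensional {q} ℚ K
  have hdim : finrank ℚ K = finrank ℚ V := by
    rw [IsCyclotomicExtension.finrank K (Polynomial.cyclotomic.irreducible_rat (NeZero.pos q)),
      Nat.totient_prime hq, hV]
    omega
  obtain ⟨ψ, σ, hψ, hσ, hψζ⟩ := exists_addChar_galois hζ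
  have hR : ∀ g, ∃ r : (ZMod q)ˣ, IsGaloisSemilinear f σ (ρ g) (r ^ 2) := fun g => by
    obtain ⟨t, ht⟩ := exists_isGaloisSemilinear_of_normal hζ hσ hψζ hf hc g
    obtain ⟨r, rfl⟩ := exists_isGaloisSemilinear_sq hω hodd hqp hV hdim hζ hσ hψζ ht
    exact ⟨r, ht⟩
  obtain ⟨v, hv, hvρ⟩ := exists_common_eigenvector hp hodd hqp hdim hζ hψ hσ hψζ hR
  obtain ⟨e, he⟩ := exists_linearEquiv_apply hdim f hv
  refine false_of_forall_eq_monomialOperator hmax hq4 (by omega) hψ hσ e fun g => ?_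
  obtain ⟨r, hr⟩ := hR g
  obtain ⟨ε, b, hεb⟩ := hvρ g
  refine ⟨ε, b, r, LinearMap.ext fun w => ?_⟩
  obtain ⟨x, rfl⟩ := e.surjective w
  have h1 : ρ g (e x) = e (monomialOperator ψ σ ε b r x) := by
    rw [he, hr.apply, hεb, ← Module.End.mul_apply, ← map_mul, he, monomialOperator_apply]
    congr 2
    ring
  rw [h1]
  simp

end WeilMaximal

section SymplecticBlocks

open Module

variable {V : Type*} [AddCommGroup V] [Module ℚ V] {G : Type*} [Group G]
  {ρ : Representation ℚ G V} {ω : LinearMap.BilinForm ℚ V}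

theorem map_representation_mul (ρ : Representation ℚ G V) (W : Submodule ℚ V) (g h : G) :
    W.map (ρ (g * h)) = (W.map (ρ h)).map (ρ g) := by
  rw [map_mul, Module.End.mul_eq_comp, Submodule.map_comp]

/-- A finite group permutes the translates of a subspace, which can be numbered. -/
theorem exists_translates [Finite G] (ρ : Representation ℚ G V) (W : Submodule ℚ V) :
    ∃ (k : ℕ) (γ : Fin k → G), (∀ i j, W.map (ρ (γ i)) = W.map (ρ (γ j)) → i = j) ∧
      ∀ g, ∃ i, W.map (ρ g) = W.map (ρ (γ i)) := by
  let S := Set.range fun g => W.map (ρ g)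
  let E : S ≃ Fin (Nat.card S) := Finite.equivFin S
  choose γ hγ using fun i => (E.symm i).2
  refine ⟨Nat.card S, γ, fun i j hij => E.symm.injective (Subtype.ext ?_), fun g =>
    ⟨E ⟨_, g, rfl⟩, ?_⟩⟩
  · rw [← hγ, ← hγ]
    exact hij
  · have := hγ (E ⟨_, g, rfl⟩)
    rw [E.symm_apply_apply] at this
    exact this.symm

/-- The translates of a subspace span an irreducible representation. -/
theorem iSup_map_eq_top (hirr : ∀ U : Submodule ℚ V, (∀ g, ∀ u ∈ U, ρ g u ∈ U) → U = ⊥ ∨ U = ⊤)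
    {W : Submodule ℚ V} (hW : W ≠ ⊥) : ⨆ g, W.map (ρ g) = ⊤ := by
  refine (hirr _ fun g u hu => ?_).resolve_left fun h => hW ?_
  · have h1 : (⨆ g, W.map (ρ g)).map (ρ g) ≤ ⨆ g, W.map (ρ g) := by
      rw [Submodule.map_iSup]
      refine iSup_le fun h => ?_
      rw [← map_representation_mul]
      exact le_iSup (fun g => W.map (ρ g)) (g * h)
    exact h1 (Submodule.mem_map_of_mem hu)
  · rw [eq_bot_iff, ← h]
    refine le_trans ?_ (le_iSup _ 1)
    rw [map_one, Module.End.one_eq_id, Submodule.map_id]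

/-- A proper subspace of an irreducible symplectic representation whose translates are equal or
orthogonal to it gives rise to a system of isometric blocks. -/
theorem IsSymplecticAction.exists_blocks [Finite G] [FiniteDimensional ℚ V]
    (hω : IsSymplecticAction ρ ω)
    (hirr : ∀ U : Submodule ℚ V, (∀ g, ∀ u ∈ U, ρ g u ∈ U) → U = ⊥ ∨ U = ⊤) {W : Submodule ℚ V}
    (hW : ∀ g, W.map (ρ g) = W ∨ ∀ v ∈ W, ∀ w ∈ W, ω v (ρ g w) = 0) (hbot : W ≠ ⊥)
    (htop : W ≠ ⊤) :
    ∃ d k : ℕ, 2 ≤ k ∧ ∃ (t : Basis (Fin k × Fin (2 * d)) ℚ V)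
      (A : Matrix (Fin (2 * d)) (Fin (2 * d)) ℚ), Aᵀ = -A ∧ IsUnit A ∧
      ∀ g, ∃ (σ : Equiv.Perm (Fin k)) (h : Fin k → Matrix (Fin (2 * d)) (Fin (2 * d)) ℚ),
        (∀ i, h i * A * (h i)ᵀ = A) ∧ ∀ i a, ρ g (t (i, a)) = ∑ c, h i a c • t (σ i, c) := by
  have hsup := iSup_map_eq_top (ρ := ρ) hirr hbot
  have hnd : ∀ v ∈ W, (∀ w ∈ W, ω v w = 0) → v = 0 := by
    intro v hv hvW
    refine hω.nondegenerate v fun x => ?_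
    have h1 : ⨆ g, W.map (ρ g) ≤ LinearMap.ker (ω v) := by
      refine iSup_le fun g => ?_
      rcases hW g with h | h
      · rw [h]
        exact hvW
      · rintro _ ⟨w, hw, rfl⟩
        exact h v hv w hw
    exact h1 (hsup ▸ Submodule.mem_top)
  obtain ⟨d, hd⟩ := (even_finrank_of_isAlt_of_nondegenerate (ω.restrict W)
    (fun v w => hω.alt v w) fun v hv => Subtype.ext (hnd v v.2 fun w hw => hv ⟨w, hw⟩)).two_dvd
  obtain ⟨k, γ, hinj, hsurj⟩ := exists_translates ρ W
  have horth : ∀ i j, i ≠ j → ∀ v ∈ W, ∀ w ∈ W, ω (ρ (γ i) v) (ρ (γ j) w) = 0 := by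
    intro i j hij v hv w hw
    rw [← hω.map_eq (γ i)⁻¹, ← Module.End.mul_apply, ← Module.End.mul_apply, ← map_mul, ← map_mul,
      inv_mul_cancel, map_one, Module.End.one_apply]
    refine (hW ((γ i)⁻¹ * γ j)).resolve_left (fun h => hij (hinj i j ?_)) v hv w hw
    have h1 := congrArg (Submodule.map (ρ (γ i))) h
    rwa [← map_representation_mul, mul_inv_cancel_left, eq_comm] at h1
  have hk : 2 ≤ k := by
    by_contra! hlt
    refine (hirr W fun g w hw => ?_).elim hbot htop
    obtain ⟨i, hi⟩ := hsurj g
    obtain ⟨j, hj⟩ := hsurj 1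
    have hij : i = j := Fin.ext (by omega)
    rw [hij, ← hj, map_one, Module.End.one_eq_id, Submodule.map_id] at hi
    exact hi ▸ Submodule.mem_map_of_mem hw
  let b : Basis (Fin (2 * d)) ℚ W := finBasisOfFinrankEq ℚ W hd
  let t : Fin k × Fin (2 * d) → V := fun x => ρ (γ x.1) (b x.2)
  let A : Matrix (Fin (2 * d)) (Fin (2 * d)) ℚ := Matrix.of fun a c => ω (b a) (b c)
  have hA : ∀ i a c, ω (t (i, a)) (t (i, c)) = A a c := fun i a c => hω.map_eq _ _ _
  have hzero : ∀ c : Fin (2 * d) → ℚ, (∀ a, ∑ x, c x * ω (b a) (b x) = 0) → c = 0 := by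
    intro c hc
    have h1 : ∑ x, c x • b x = 0 := by
      refine Subtype.ext (hnd _ (∑ x, c x • b x).2 fun w hw => ?_)
      rw [hω.alt, neg_eq_zero]
      have h2 : W.subtype.range ≤ LinearMap.ker (ω.flip (∑ x, c x • b x : W)) := by
        rw [LinearMap.range_eq_map, ← b.span_eq, Submodule.map_span_le]
        rintro _ ⟨a, rfl⟩
        simpa using hc a
      exact h2 ⟨⟨w, hw⟩, rfl⟩
    funext x
    exact Fintype.linearIndependent_iff.mp b.linearIndependent c h1 x
  have hli : LinearIndependent ℚ t := by
    rw [Fintype.linearIndependent_iff]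
    rintro c hc ⟨i, a⟩
    refine congrFun (hzero (fun a => c (i, a)) fun a' => ?_) a
    have h1 : ω (t (i, a')) (∑ x, c x • t x) = 0 := by rw [hc, map_zero]
    rw [map_sum, Fintype.sum_prod_type, Finset.sum_eq_single i] at h1
    · simpa [hA, A] using h1
    · intro j _ hj
      refine Finset.sum_eq_zero fun x _ => ?_
      rw [map_smul, horth i j hj.symm _ (b a').2 _ (b x).2, smul_zero]
    · simp
  have hspan : ⊤ ≤ Submodule.span ℚ (Set.range t) := by
    rw [← hsup]
    refine iSup_le fun g => ?_
    obtain ⟨i, hi⟩ := hsurj g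
    rw [hi]
    rintro _ ⟨w, hw, rfl⟩
    have h1 := congrArg (ρ (γ i) ∘ₗ W.subtype) (b.sum_repr ⟨w, hw⟩)
    rw [map_sum] at h1
    change _ = ρ (γ i) w at h1
    rw [← h1]
    refine Submodule.sum_mem _ fun a _ => ?_
    rw [map_smul]
    exact Submodule.smul_mem _ _ (Submodule.subset_span ⟨(i, a), rfl⟩)
  refine ⟨d, k, hk, Basis.mk hli hspan, A, ?_, ?_, fun g => ?_⟩
  · ext a c
    exact hω.alt _ _
  · rw [← Matrix.mulVec_injective_iff_isUnit]
    refine (injective_iff_map_eq_zero (Matrix.mulVecLin A)).mpr fun c hc => hzero c fun a => ?_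
    have := congrFun hc a
    simpa [Matrix.mulVec, dotProduct, A, mul_comm] using this
  · choose s hs using fun i => hsurj (g * γ i)
    have hsinj : Function.Injective s := by
      intro i j hij
      have h1 : W.map (ρ (g * γ i)) = W.map (ρ (g * γ j)) := by rw [hs, hs, hij]
      refine hinj i j ?_
      rw [map_representation_mul, map_representation_mul] at h1
      have h2 := congrArg (Submodule.map (ρ g⁻¹)) h1
      rwa [← map_representation_mul, ← map_representation_mul, ← map_representation_mul,
        ← map_representation_mul, inv_mul_cancel, one_mul, one_mul] at h2
    have hmem : ∀ i a, ρ ((γ (s i))⁻¹ * (g * γ i)) (b a) ∈ W := by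
      intro i a
      have h1 : W.map (ρ ((γ (s i))⁻¹ * (g * γ i))) = W := by
        rw [map_representation_mul, hs, ← map_representation_mul, inv_mul_cancel, map_one,
          Module.End.one_eq_id, Submodule.map_id]
      exact h1.le (Submodule.mem_map_of_mem (b a).2)
    let h : Fin k → Matrix (Fin (2 * d)) (Fin (2 * d)) ℚ := fun i =>
      Matrix.of fun a c => b.repr ⟨_, hmem i a⟩ c
    have hg : ∀ i a, ρ g (t (i, a)) = ∑ c, h i a c • t (s i, c) := by
      intro i a
      have h1 := congrArg (ρ (γ (s i)) ∘ₗ W.subtype) (b.sum_repr ⟨_, hmem i a⟩)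
      rw [map_sum] at h1
      change _ = ρ (γ (s i)) (ρ ((γ (s i))⁻¹ * (g * γ i)) (b a)) at h1
      have h2 : ρ g (t (i, a)) = ρ (γ (s i)) (ρ ((γ (s i))⁻¹ * (g * γ i)) (b a)) := by
        rw [← Module.End.mul_apply (ρ (γ (s i))), ← map_mul, mul_inv_cancel_left, map_mul,
          Module.End.mul_apply]
      rw [h2, ← h1]
      refine Finset.sum_congr rfl fun c _ => ?_
      rw [map_smul]
      rfl
    refine ⟨Equiv.ofBijective s (Finite.injective_iff_bijective.mp hsinj), h, fun i => ?_,
      fun i a => ?_⟩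
    · ext a c
      rw [← hA i a c, ← hω.map_eq g, hg, hg]
      simp only [map_sum, map_smul, LinearMap.sum_apply, LinearMap.smul_apply, hA,
        Matrix.mul_apply, Matrix.transpose_apply, smul_eq_mul]
      refine Finset.sum_congr rfl fun y _ => ?_
      rw [Finset.sum_mul, Finset.mul_sum]
      refine Finset.sum_congr rfl fun x _ => by ring
    · simpa using hg i a

end SymplecticBlocks

section RowRepresentation

open Module

variable {ι : Type*} [Fintype ι] [DecidableEq ι]

/-- The action of `GL` on row vectors, turned into a left action by inverting. -/
def rowRepresentation (ι : Type*) [Fintype ι] [DecidableEq ι] :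
    Representation ℚ (GL ι ℚ) (ι → ℚ) where
  toFun g := Matrix.vecMulLinear ((g⁻¹ : GL ι ℚ) : Matrix ι ι ℚ)
  map_one' := by
    ext
    simp
  map_mul' g h := LinearMap.ext fun v => by
    simp only [Matrix.vecMulLinear_apply, Module.End.mul_apply, _root_.mul_inv_rev, Units.val_mul,
      Matrix.vecMul_vecMul]

theorem rowRepresentation_apply (g : GL ι ℚ) (v : ι → ℚ) :
    rowRepresentation ι g v = v ᵥ* ((g⁻¹ : GL ι ℚ) : Matrix ι ι ℚ) :=
  rfl

theorem rowRepresentation_injective : Function.Injective (rowRepresentation ι) := by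
  intro g h hgh
  rw [← _root_.inv_inj]
  refine Units.ext (funext fun i => ?_)
  have := LinearMap.congr_fun hgh (Pi.single i 1)
  rwa [rowRepresentation_apply, rowRepresentation_apply, Matrix.single_one_vecMul,
    Matrix.single_one_vecMul] at this

theorem rowRepresentation_surjective (h : (End ℚ (ι → ℚ))ˣ) :
    ∃ g, rowRepresentation ι g = h := by
  have key : ∀ a b : End ℚ (ι → ℚ), a * b = 1 →
      (LinearMap.toMatrix' b)ᵀ * (LinearMap.toMatrix' a)ᵀ = 1 := fun a b hab => by
    rw [← Matrix.transpose_mul, ← LinearMap.toMatrix'_mul, hab, LinearMap.toMatrix'_one,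
      Matrix.transpose_one]
  let M : GL ι ℚ := ⟨(LinearMap.toMatrix' (h : End ℚ (ι → ℚ)))ᵀ,
    (LinearMap.toMatrix' ((h⁻¹ : (End ℚ (ι → ℚ))ˣ) : End ℚ (ι → ℚ)))ᵀ,
    key _ _ h.inv_mul, key _ _ h.mul_inv⟩
  refine ⟨M⁻¹, LinearMap.ext fun v => ?_⟩
  rw [rowRepresentation_apply, inv_inv]
  change v ᵥ* (LinearMap.toMatrix' _)ᵀ = _
  rw [Matrix.vecMul_transpose, LinearMap.toMatrix'_mulVec]

theorem isSymplecticAction_rowRepresentation {G : Subgroup (GL ι ℚ)} {A : Matrix ι ι ℚ}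
    (hA : Aᵀ = -A) (hunit : IsUnit A)
    (hG : ∀ g ∈ G, (g : Matrix ι ι ℚ) * A * (g : Matrix ι ι ℚ)ᵀ = A) :
    IsSymplecticAction ((rowRepresentation ι).comp G.subtype) (Matrix.toBilin' A) where
  injective := rowRepresentation_injective.comp G.subtype_injective
  alt v w := by
    rw [Matrix.toBilin'_apply', Matrix.toBilin'_apply', Matrix.dotProduct_mulVec,
      ← Matrix.mulVec_transpose, hA, Matrix.neg_mulVec, neg_dotProduct, dotProduct_comm]
  nondegenerate v hv := by
    apply Matrix.vecMul_injective_of_isUnit hunit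
    change v ᵥ* A = 0 ᵥ* A
    rw [Matrix.zero_vecMul]
    refine dotProduct_eq_zero _ fun w => ?_
    rw [← Matrix.dotProduct_mulVec, ← Matrix.toBilin'_apply', hv]
  map_eq g v w := by
    have h := hG _ (inv_mem g.2)
    rw [MonoidHom.comp_apply, Subgroup.subtype_apply, rowRepresentation_apply,
      rowRepresentation_apply]
    rw [Matrix.toBilin'_apply', Matrix.toBilin'_apply', ← Matrix.mulVec_transpose _ w,
      ← Matrix.dotProduct_mulVec, Matrix.mulVec_mulVec, Matrix.mulVec_mulVec, h]

/-- A form preserved by row operations, in matrix terms. -/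
theorem exists_matrix_of_bilinForm {H : Subgroup (GL ι ℚ)} {ω : LinearMap.BilinForm ℚ (ι → ℚ)}
    (halt : ∀ v w, ω v w = -ω w v) (hnd : ∀ v, (∀ w, ω v w = 0) → v = 0)
    (hH : ∀ h ∈ H, ∀ v w, ω (rowRepresentation ι h v) (rowRepresentation ι h w) = ω v w) :
    ∃ A : Matrix ι ι ℚ, Aᵀ = -A ∧ IsUnit A ∧
      ∀ g ∈ H, (g : Matrix ι ι ℚ) * A * (g : Matrix ι ι ℚ)ᵀ = A := by
  have happly : ∀ v w, ω v w = v ⬝ᵥ LinearMap.BilinForm.toMatrix' ω *ᵥ w := fun v w => by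
    rw [← Matrix.toBilin'_apply', Matrix.toBilin'_toMatrix']
  refine ⟨LinearMap.BilinForm.toMatrix' ω, ?_, ?_, fun g hg => ?_⟩
  · ext i j
    rw [Matrix.transpose_apply, Matrix.neg_apply, LinearMap.BilinForm.toMatrix'_apply,
      LinearMap.BilinForm.toMatrix'_apply, halt]
  · rw [← Matrix.vecMul_injective_iff_isUnit]
    refine (injective_iff_map_eq_zero (Matrix.vecMulLinear _)).mpr fun v hv => hnd v fun w => ?_
    rw [happly, Matrix.dotProduct_mulVec]
    change v ᵥ* _ = 0 at hv
    rw [hv, zero_dotProduct]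
  · ext i j
    have h := hH _ (inv_mem hg) (Pi.single i 1) (Pi.single j 1)
    rw [rowRepresentation_apply, rowRepresentation_apply, inv_inv, happly,
      ← Matrix.mulVec_transpose _ (Pi.single j 1), ← Matrix.dotProduct_mulVec, Matrix.mulVec_mulVec,
      Matrix.mulVec_mulVec, ← LinearMap.BilinForm.toMatrix'_apply] at h
    rw [← h, Matrix.mulVec_single_one, single_one_dotProduct, Matrix.col_apply]

end RowRepresentation

section MatrixGroups

open Module

variable {n : ℕ} {G : Subgroup (GL (Fin n ⊕ Fin n) ℚ)}

theorem IsRatIrreducible.eq_bot_or_eq_top (hG : IsRatIrreducible G)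
    (U : Submodule ℚ (Fin n ⊕ Fin n → ℚ))
    (hU : ∀ g, ∀ u ∈ U, (rowRepresentation _).comp G.subtype g u ∈ U) : U = ⊥ ∨ U = ⊤ := by
  refine hG U fun g hg v hv => ?_
  have h := hU ⟨g, hg⟩⁻¹ v hv
  rwa [MonoidHom.comp_apply, Subgroup.subtype_apply, InvMemClass.coe_inv, rowRepresentation_apply,
    inv_inv] at h

theorem IsSPIMF.isMaximalSymplectic (hG : IsSPIMF G) :
    IsMaximalSymplectic ((rowRepresentation _).comp G.subtype) := by
  intro H hfin ⟨ω, halt, hnd, hω⟩ hle h hh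
  let Φ := (rowRepresentation (Fin n ⊕ Fin n)).toHomUnits
  have hΦ : Function.Injective Φ := fun a b hab =>
    rowRepresentation_injective (Units.ext_iff.mp hab)
  have hHG : H.comap Φ = G := by
    refine hG.2.2.2.2 _ ?_ ?_ fun g hg => ?_
    · have hs : (H : Set (End ℚ (Fin n ⊕ Fin n → ℚ))ˣ).Finite := hfin
      have hpre : (Φ ⁻¹' (H : Set _)).Finite := hs.preimage hΦ.injOn
      exact hpre
    · exact exists_matrix_of_bilinForm halt hnd fun g hg v w => hω _ hg v w
    · obtain ⟨h, hh, heq⟩ := hle ⟨g, hg⟩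
      have : Φ g = h := Units.ext heq.symm
      exact Subgroup.mem_comap.mpr (this ▸ hh)
  obtain ⟨g, hg⟩ := rowRepresentation_surjective h
  have hgh : Φ g = h := Units.ext hg
  exact ⟨⟨g, hHG ▸ Subgroup.mem_comap.mpr (hgh ▸ hh)⟩, hg⟩

theorem IsSPIMF.neg_one_mem (hG : IsSPIMF G) : -1 ∈ G := by
  let H : Subgroup (GL (Fin n ⊕ Fin n) ℚ) :=
    { carrier := {h | h ∈ G ∨ -h ∈ G}
      one_mem' := Or.inl G.one_mem
      mul_mem' := by
        rintro a b (ha | ha) (hb | hb)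
        · exact Or.inl (mul_mem ha hb)
        · exact Or.inr (by simpa using mul_mem ha hb)
        · exact Or.inr (by simpa using mul_mem ha hb)
        · exact Or.inl (by simpa using mul_mem ha hb)
      inv_mem' := by
        rintro a (ha | ha)
        · exact Or.inl (inv_mem ha)
        · exact Or.inr (by simpa using inv_mem ha) }
  have hfin := hG.1
  obtain ⟨A, hA, hunit, hGA⟩ := hG.2.1
  have hHG : H = G := by
    refine hG.2.2.2.2 H ?_ ⟨A, hA, hunit, ?_⟩ fun g hg => Or.inl hg
    · refine (hfin.union (hfin.preimage neg_injective.injOn)).subset ?_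
      rintro g (hg | hg)
      · exact Or.inl hg
      · exact Or.inr hg
    · rintro g (hg | hg)
      · exact hGA g hg
      · simpa using hGA _ hg
  rw [← hHG]
  exact Or.inr (by simp [G.one_mem])

/-- A system of isometric blocks makes a matrix group symplectic imprimitive. -/
theorem isSympImprimitive_of_blocks {d k : ℕ} (hk : 2 ≤ k)
    (t : Basis (Fin k × Fin (2 * d)) ℚ (Fin n ⊕ Fin n → ℚ))
    {A : Matrix (Fin (2 * d)) (Fin (2 * d)) ℚ} (hA : Aᵀ = -A) (hunit : IsUnit A)
    (hblock : ∀ g, ∃ (σ : Equiv.Perm (Fin k)) (h : Fin k → Matrix (Fin (2 * d)) (Fin (2 * d)) ℚ),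
      (∀ i, h i * A * (h i)ᵀ = A) ∧ ∀ i a, (rowRepresentation _).comp G.subtype g (t (i, a)) =
        ∑ c, h i a c • t (σ i, c)) : IsSympImprimitive G := by
  have hcard := finrank_eq_card_basis t
  rw [finrank_fintype_fun_eq_card, Fintype.card_sum, Fintype.card_prod, Fintype.card_fin,
    Fintype.card_fin, Fintype.card_fin] at hcard
  let e : Fin k × Fin (2 * d) ≃ Fin n ⊕ Fin n := Fintype.equivOfCardEq (by simpa using hcard.symm)
  let M : Matrix (Fin n ⊕ Fin n) (Fin n ⊕ Fin n) ℚ := Matrix.of fun x => t (e.symm x)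
  have hM : IsUnit M := by
    rw [← Matrix.linearIndependent_rows_iff_isUnit]
    exact t.linearIndependent.comp _ e.symm.injective
  obtain ⟨T, hT⟩ := hM
  refine ⟨d, k, by nlinarith, hk, e, A, T, hA, hunit, fun g hg => ?_⟩
  obtain ⟨σ, h, hh, hσ⟩ := hblock ⟨g, hg⟩⁻¹
  refine ⟨σ, h, hh, ?_⟩
  rw [Units.val_mul, Units.mul_inv_eq_iff_eq_mul, Units.val_mul, hT]
  refine funext fun x => ?_
  obtain ⟨⟨i, a⟩, rfl⟩ := e.surjective x
  have h1 := hσ i a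
  rw [MonoidHom.comp_apply, Subgroup.subtype_apply, InvMemClass.coe_inv, rowRepresentation_apply,
    inv_inv] at h1
  have h2 : M (e (i, a)) = t (i, a) := congrArg t (e.symm_apply_apply _)
  rw [Matrix.mul_apply_eq_vecMul, Matrix.mul_apply_eq_vecMul, h2, h1]
  ext y
  simp only [Matrix.vecMul, dotProduct]
  rw [← e.sum_comp, Fintype.sum_prod_type, Finset.sum_eq_single (σ i)]
  · simp [M]
  · intro j _ hj
    simp [hj.symm]
  · simp

theorem IsSPIMF.eq_bot_or_eq_top (hG : IsSPIMF G) {A : Matrix (Fin n ⊕ Fin n) (Fin n ⊕ Fin n) ℚ}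
    (hω : IsSymplecticAction ((rowRepresentation _).comp G.subtype) (Matrix.toBilin' A))
    (W : Submodule ℚ (Fin n ⊕ Fin n → ℚ))
    (hW : ∀ g, W.map ((rowRepresentation _).comp G.subtype g) = W ∨ ∀ v ∈ W, ∀ w ∈ W,
      Matrix.toBilin' A v ((rowRepresentation _).comp G.subtype g w) = 0) : W = ⊥ ∨ W = ⊤ := by
  by_contra! h
  have : Finite G := hG.1
  obtain ⟨d, k, hk, t, B, hB, hunit, hblock⟩ :=
    hω.exists_blocks hG.2.2.1.eq_bot_or_eq_top hW h.1 h.2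
  exact hG.2.2.2.1 (isSympImprimitive_of_blocks hk t hB hunit hblock)

end MatrixGroups

/-- If `p ≥ 5` is prime and `G ≤ Sp_{2p}(ℚ)` is s.p.i.m.f., then the Fitting subgroup of
`G` is cyclic of order `2`, `4` or `6`. -/
theorem spimf_dim_two_p_fitting {p : ℕ} (hp : p.Prime) (hp5 : 5 ≤ p)
    (G : Subgroup (GL (Fin p ⊕ Fin p) ℚ))
    (hSp : ∀ g ∈ G, (g : Matrix (Fin p ⊕ Fin p) (Fin p ⊕ Fin p) ℚ) ∈
      Matrix.symplecticGroup (Fin p) ℚ)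
    (hG : IsSPIMF G) :
    ∃ F : Subgroup G, F.Normal ∧ Group.IsNilpotent F ∧
      (∀ N : Subgroup G, N.Normal → Group.IsNilpotent N → N ≤ F) ∧
      IsCyclic F ∧ (Nat.card F = 2 ∨ Nat.card F = 4 ∨ Nat.card F = 6) := by
  have : Finite G := hG.1
  obtain ⟨A, hA, hunit, hGA⟩ := hG.2.1
  have hω := isSymplecticAction_rowRepresentation hA hunit hGA
  have hV : Module.finrank ℚ (Fin p ⊕ Fin p → ℚ) = 2 * p := by
    rw [Module.finrank_fintype_fun_eq_card, Fintype.card_sum, Fintype.card_fin, two_mul]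
  have hab := hasSmallAbelianNormals_of_primitive hω hp hp5 hV (hG.eq_bot_or_eq_top hω)
    (hG.isMaximalSymplectic.aeval_cyclotomic_ne_zero hω hp hp5 hV)
  refine hab.exists_fitting hω hp hp5 hV (s := ⟨-1, hG.neg_one_mem⟩) (LinearMap.ext fun v => ?_)
  rw [MonoidHom.comp_apply, Subgroup.subtype_apply, rowRepresentation_apply]
  simp [Matrix.vecMul_neg]
end

section
/- Let N ≤ GL_{2n}(ℚ) be a finite subgroup and suppose its commuting algebra Q := End(N) is a quaternion algebra, i.e., a central simple algebra of dimension 4 over its center K. Let x ∈ GL_{2n}(ℚ) be such that x·N·x⁻¹ = N, x² ∈ N, x commutes with every element of K, and x does not commute with every element of Q. Then there exists a ∈ Q with a ∉ K and a² ∈ K such that End(⟨N, x⟩) = K[a] = {q ∈ Q : q·a = a·q} (the centralizer of a in Q); in particular, End(⟨N, x⟩) is a commutative K-algebra of dimension 2 over K, isomorphic to K[X]/(X² − a²). -/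
open Matrix
open scoped MatrixGroups

set_option synthInstance.maxHeartbeats 1000000
set_option maxHeartbeats 4000000

/-- The commuting algebra `End(N)` of `N ≤ GL_m(ℚ)`, as a `ℚ`-subalgebra of the matrix
algebra `ℚ^{m×m}`. -/
def endAlg {m : ℕ} (N : Subgroup (GL (Fin m) ℚ)) :
    Subalgebra ℚ (Matrix (Fin m) (Fin m) ℚ) :=
  Subalgebra.centralizer ℚ
    ((fun g : GL (Fin m) ℚ => (g : Matrix (Fin m) (Fin m) ℚ)) '' (N : Set (GL (Fin m) ℚ)))

open scoped TensorProduct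

namespace Algebra.IsCentral

variable {K A : Type*} [Field K] [Ring A] [Algebra K A] [IsSimpleRing A]

/-- A simple ring is simple as a bimodule over itself. -/
theorem isSimpleModule_tensorProduct_mop :
    letI : Module (A ⊗[K] Aᵐᵒᵖ) A := TensorProduct.Algebra.module
    IsSimpleModule (A ⊗[K] Aᵐᵒᵖ) A := by
  let : Module (A ⊗[K] Aᵐᵒᵖ) A := TensorProduct.Algebra.module
  have smul_def (a : A) (b : Aᵐᵒᵖ) (x : A) : (a ⊗ₜ[K] b) • x = a * x * b.unop := by
    rw [TensorProduct.Algebra.smul_def, MulOpposite.smul_eq_mul_unop, smul_eq_mul, mul_assoc]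
  refine { eq_bot_or_eq_top := fun P => or_iff_not_imp_left.mpr fun hP => ?_ }
  obtain ⟨y, hyP, hy⟩ := P.exists_mem_ne_zero_of_ne_bot hP
  have hl {u v : A} (hv : v ∈ P) : u * v ∈ P := by
    simpa [smul_def] using P.smul_mem (u ⊗ₜ[K] 1) hv
  have hr {u v : A} (hu : u ∈ P) : u * v ∈ P := by
    simpa [smul_def] using P.smul_mem (1 ⊗ₜ[K] MulOpposite.op v) hu
  have h1 : (1 : A) ∈ P := by
    simpa using IsSimpleRing.one_mem_of_ne_zero_mem
      (TwoSidedIdeal.mk' (P : Set A) P.zero_mem P.add_mem P.neg_mem hl hr) hy (by simpa using hyP)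
  exact (Submodule.eq_top_iff').mpr fun z => by simpa using hl (u := z) h1

variable [Algebra.IsCentral K A] [FiniteDimensional K A]

theorem mulLeftRight_surjective : Function.Surjective (AlgHom.mulLeftRight K A) := by
  let : Module (A ⊗[K] Aᵐᵒᵖ) A := TensorProduct.Algebra.module
  have smul_def (a : A) (b : Aᵐᵒᵖ) (x : A) : (a ⊗ₜ[K] b) • x = a * x * b.unop := by
    rw [TensorProduct.Algebra.smul_def, MulOpposite.smul_eq_mul_unop, smul_eq_mul, mul_assoc]
  have : IsSimpleModule (A ⊗[K] Aᵐᵒᵖ) A := isSimpleModule_tensorProduct_mop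
  classical
  intro f
  have key (φ : Module.End (A ⊗[K] Aᵐᵒᵖ) A) : ∃ k : K, ∀ y, φ y = k • y := by
    have h1 (y : A) : φ y = y * φ 1 := by
      simpa [smul_def] using φ.map_smul (y ⊗ₜ[K] 1) 1
    have h2 (y : A) : φ y = φ 1 * y := by
      simpa [smul_def] using φ.map_smul (1 ⊗ₜ[K] MulOpposite.op y) 1
    have hc : φ 1 ∈ Subalgebra.center K A :=
      Subalgebra.mem_center_iff.mpr fun y => (h1 y).symm.trans (h2 y)
    obtain ⟨k, hk⟩ := Algebra.mem_bot.mp (Algebra.IsCentral.out hc)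
    exact ⟨k, fun y => by rw [h2, ← hk, Algebra.smul_def]⟩
  let F : Module.End (Module.End (A ⊗[K] Aᵐᵒᵖ) A) A :=
    { toFun := f
      map_add' := map_add f
      map_smul' := fun φ y => by
        obtain ⟨k, hk⟩ := key φ
        simp [hk] }
  let b := Module.finBasis K A
  obtain ⟨r, hr⟩ := jacobson_density F (Finset.univ.image b)
  refine ⟨r, b.ext fun i => ?_⟩
  exact (hr (b i) (Finset.mem_image_of_mem _ (Finset.mem_univ i))).symm

/-- A finite-dimensional central simple algebra is an Azumaya algebra. -/
theorem mulLeftRight_bijective : Function.Bijective (AlgHom.mulLeftRight K A) := by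
  refine ⟨?_, mulLeftRight_surjective⟩
  refine (LinearMap.injective_iff_surjective_of_finrank_eq_finrank
    (f := (AlgHom.mulLeftRight K A).toLinearMap) ?_).mpr mulLeftRight_surjective
  rw [Module.finrank_tensorProduct, Module.finrank_linearMap,
    LinearEquiv.finrank_eq (MulOpposite.opLinearEquiv K : A ≃ₗ[K] Aᵐᵒᵖ)]

/-- The Skolem–Noether theorem for automorphisms. -/
theorem exists_isUnit_forall_mul_eq (σ : A ≃ₐ[K] A) :
    ∃ a : A, IsUnit a ∧ ∀ q, a * q = σ q * a := by
  obtain ⟨T, hT⟩ := (mulLeftRight_bijective (K := K) (A := A)).2 σ.toLinearMap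
  have hT' (q : A) : AlgHom.mulLeftRight K A T q = σ q := congr($hT q)
  have comm (q : A) : T * (q ⊗ₜ 1) = (σ q ⊗ₜ 1) * T := by
    refine (mulLeftRight_bijective (K := K) (A := A)).1 (LinearMap.ext fun y => ?_)
    simp [hT']
  let e := TensorProduct.equivFinsuppOfBasisRight (M := A) (Module.finBasis K Aᵐᵒᵖ)
  have e_right (S : A ⊗[K] Aᵐᵒᵖ) (q : A) (i) : e (S * (q ⊗ₜ 1)) i = e S i * q := by
    induction S with
    | zero => simp
    | add x y hx hy => simp [add_mul, hx, hy]
    | tmul x y => simp [e]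
  have e_left (S : A ⊗[K] Aᵐᵒᵖ) (q : A) (i) : e ((q ⊗ₜ 1) * S) i = q * e S i := by
    induction S with
    | zero => simp
    | add x y hx hy => simp [mul_add, hx, hy]
    | tmul x y => simp [e]
  have hT0 : e T ≠ 0 := by
    rw [Ne, e.map_eq_zero_iff]
    rintro rfl
    simpa using hT' 1
  obtain ⟨i, hi⟩ := Finsupp.ne_iff.mp hT0
  have ha (q : A) : e T i * q = σ q * e T i := by rw [← e_right, comm, e_left]
  generalize e T i = a at hi ha
  have ha' (q : A) : q * a = a * σ.symm q := by simp [ha]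
  have h1 : ∃ r, a * r = 1 := by
    have := IsSimpleRing.one_mem_of_ne_zero_mem (TwoSidedIdeal.mk' {y | ∃ r, a * r = y}
      ⟨0, mul_zero a⟩ (by rintro _ _ ⟨r, rfl⟩ ⟨s, rfl⟩; exact ⟨r + s, mul_add a r s⟩)
      (by rintro _ ⟨r, rfl⟩; exact ⟨-r, mul_neg a r⟩)
      (by rintro x _ ⟨r, rfl⟩; exact ⟨σ.symm x * r, by rw [← mul_assoc, ← ha', mul_assoc]⟩)
      (by rintro _ x ⟨r, rfl⟩; exact ⟨r * x, (mul_assoc a r x).symm⟩)) hi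
      (by simpa using ⟨1, mul_one a⟩)
    simpa using this
  obtain ⟨r, hr⟩ := h1
  have : IsNoetherianRing A := isNoetherian_of_tower K inferInstance
  exact ⟨a, .of_mul_eq_one r hr, ha⟩

end Algebra.IsCentral

/-- In a quaternion algebra over a field of characteristic different from two, the fixed ring of
a nontrivial involutive automorphism is generated by a single noncentral element, whose square is
central, and it is the centralizer of that element. -/
theorem exists_adjoin_eq_centralizer_of_involutive {K A : Type*} [Field K] [Ring A] [Algebra K A]
    [Algebra.IsCentral K A] [IsSimpleRing A] (h2 : (2 : K) ≠ 0) (hdim : Module.finrank K A = 4)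
    (σ : A ≃ₐ[K] A) (hσ : ∀ q, σ (σ q) = q) (hne : ∃ q, σ q ≠ q) :
    ∃ a : A, a ∉ Subalgebra.center K A ∧ a * a ∈ Subalgebra.center K A ∧
      (∀ q, σ q = q ↔ q ∈ Algebra.adjoin K {a}) ∧
      Algebra.adjoin K {a} = Subalgebra.centralizer K {a} := by
  have : FiniteDimensional K A := .of_finrank_pos (by omega)
  obtain ⟨a, hu, ha⟩ := Algebra.IsCentral.exists_isUnit_forall_mul_eq σ
  have hfix (q : A) : σ q = q ↔ q ∈ Subalgebra.centralizer K {a} := by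
    simp only [Subalgebra.mem_centralizer_iff, Set.mem_singleton_iff, forall_eq, ha,
      hu.mul_left_inj]
  have hac : a ∉ Subalgebra.center K A := fun h => by
    obtain ⟨q, hq⟩ := hne
    exact hq <| hu.mul_left_inj.mp <| by rw [← ha, Subalgebra.mem_center_iff.mp h]
  have haa : a * a ∈ Subalgebra.center K A := Subalgebra.mem_center_iff.mpr fun q => by
    rw [mul_assoc a a q, ha q, ← mul_assoc a, ha (σ q), hσ, mul_assoc]
  let C : Submodule K A := LinearMap.eqLocus σ.toLinearMap LinearMap.id
  let D : Submodule K A := LinearMap.eqLocus σ.toLinearMap (-LinearMap.id)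
  have memC {q : A} : q ∈ C ↔ σ q = q := by simp [C]
  have memD {q : A} : q ∈ D ↔ σ q = -q := by simp [D]
  have hsup : C ⊔ D = ⊤ := eq_top_iff.mpr fun q _ => by
    refine Submodule.mem_sup.mpr ⟨(2 : K)⁻¹ • (q + σ q), ?_, (2 : K)⁻¹ • (q - σ q), ?_, ?_⟩
    · simp [memC, hσ, add_comm]
    · simp [memD, hσ, ← smul_neg]
    · rw [← smul_add, add_add_sub_cancel, ← two_smul K q, inv_smul_smul₀ h2]
  have hdisj : Disjoint C D := Submodule.disjoint_def.mpr fun q hc hd => by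
    have h : q = -q := (memC.mp hc).symm.trans (memD.mp hd)
    have : (2 : K) • q = 0 := by rw [two_smul]; nth_rw 1 [h]; exact neg_add_cancel q
    exact (smul_eq_zero.mp this).resolve_left h2
  have hCD : C * D ≤ D := Submodule.mul_le.mpr fun c hc d hd => by
    rw [memD, map_mul, memC.mp hc, memD.mp hd, mul_neg]
  have hDC : D * C ≤ D := Submodule.mul_le.mpr fun d hd c hc => by
    rw [memD, map_mul, memC.mp hc, memD.mp hd, neg_mul]
  have hDD : D * D ≤ C := Submodule.mul_le.mpr fun c hc d hd => by
    rw [memC, map_mul, memD.mp hc, memD.mp hd, neg_mul_neg]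
  have hleft : ⊤ * (D ⊔ D * D) ≤ D ⊔ D * D := by
    rw [← hsup, Submodule.sup_mul, Submodule.mul_sup, Submodule.mul_sup, ← mul_assoc C D D]
    refine sup_le (sup_le_sup hCD (mul_le_mul_left hCD D)) (sup_le le_sup_right ?_)
    exact (mul_le_mul_right hDD D).trans (hDC.trans le_sup_left)
  have hright : (D ⊔ D * D) * ⊤ ≤ D ⊔ D * D := by
    rw [← hsup, Submodule.mul_sup, Submodule.sup_mul, Submodule.sup_mul, mul_assoc D D C]
    refine sup_le (sup_le_sup hDC (mul_le_mul_right hDC D)) (sup_le le_sup_right ?_)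
    exact (mul_le_mul_left hDD D).trans (hCD.trans le_sup_left)
  obtain ⟨d, hd, hd0⟩ : ∃ d ∈ D, d ≠ 0 := by
    obtain ⟨q, hq⟩ := hne
    exact ⟨q - σ q, by simp [memD, hσ], sub_ne_zero.mpr hq.symm⟩
  have hone : (1 : A) ∈ D ⊔ D * D := by
    simpa using IsSimpleRing.one_mem_of_ne_zero_mem
      (TwoSidedIdeal.mk' (D ⊔ D * D : Submodule K A) (zero_mem _) add_mem neg_mem
        (fun h => hleft (Submodule.mul_mem_mul trivial h))
        (fun h => hright (Submodule.mul_mem_mul h trivial))) hd0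
      (by simpa using Submodule.mem_sup_left hd)
  have hCle : C ≤ D * D := fun c hc => by
    have h := hleft (Submodule.mul_mem_mul (Submodule.mem_top (x := c)) hone)
    rw [mul_one] at h
    obtain ⟨y, hy, z, hz, rfl⟩ := Submodule.mem_sup.mp h
    have : y = 0 := Submodule.disjoint_def.mp hdisj y
      (by simpa using C.sub_mem hc (hDD hz)) hy
    simpa [this] using hz
  let B := Subalgebra.toSubmodule (Algebra.adjoin K {a})
  have hBC : B ≤ C := fun q hq => memC.mpr <| (hfix q).mpr <|
    (Algebra.adjoin_le (by simp [Set.mem_centralizer_iff]) : Algebra.adjoin K {a} ≤ _) hq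
  have not_le (b : A) : ¬ B ≤ K ∙ b := fun h => by
    have h1 : (1 : A) ∈ K ∙ b := h (one_mem (Algebra.adjoin K {a}))
    have h2 : a ∈ K ∙ b := h (Algebra.self_mem_adjoin_singleton K a)
    obtain ⟨r, hr⟩ := Submodule.mem_span_singleton.mp h1
    obtain ⟨s, rfl⟩ := Submodule.mem_span_singleton.mp h2
    have hr0 : r ≠ 0 := by rintro rfl; simp at hr
    refine hac ?_
    have : b = algebraMap K A r⁻¹ := by
      rw [Algebra.algebraMap_eq_smul_one, ← hr, inv_smul_smul₀ hr0]
    rw [this]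
    exact Subalgebra.smul_mem _ (Subalgebra.algebraMap_mem _ _) _
  have hB2 : 2 ≤ Module.finrank K B := by
    by_contra! hlt
    obtain ⟨b, hb⟩ := ((Submodule.finrank_le_one_iff_isPrincipal B).mp (by omega)).principal
    exact not_le b hb.le
  have hD2 : 2 ≤ Module.finrank K D := by
    by_contra! hlt
    obtain ⟨b, hb⟩ := ((Submodule.finrank_le_one_iff_isPrincipal D).mp (by omega)).principal
    refine not_le (b * b) (hBC.trans (hCle.trans ?_))
    rw [hb, Submodule.span_mul_span, Set.singleton_mul_singleton]
  have hsum : Module.finrank K C + Module.finrank K D = 4 := by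
    rw [← hdim]
    exact Submodule.finrank_add_eq_of_isCompl ⟨hdisj, codisjoint_iff.mpr hsup⟩
  have hBCeq : B = C := Submodule.eq_of_le_of_finrank_le hBC (by omega)
  have hadj (q : A) : σ q = q ↔ q ∈ Algebra.adjoin K {a} := by
    rw [← memC, ← hBCeq, Subalgebra.mem_toSubmodule]
  exact ⟨a, hac, haa, hadj, SetLike.ext fun q => (hadj q).symm.trans (hfix q)⟩

theorem mem_endAlg_iff {m : ℕ} {N : Subgroup (GL (Fin m) ℚ)} {q : Matrix (Fin m) (Fin m) ℚ} :
    q ∈ endAlg N ↔ ∀ g ∈ N, (g : Matrix (Fin m) (Fin m) ℚ) * q = q * g := by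
  simp [endAlg, Subalgebra.mem_centralizer_iff]

theorem mem_endAlg_closure_insert_iff {m : ℕ} {N : Subgroup (GL (Fin m) ℚ)} {x : GL (Fin m) ℚ}
    {q : Matrix (Fin m) (Fin m) ℚ} :
    q ∈ endAlg (Subgroup.closure (insert x (N : Set (GL (Fin m) ℚ)))) ↔
      q ∈ endAlg N ∧ (x : Matrix (Fin m) (Fin m) ℚ) * q = q * x := by
  simp only [mem_endAlg_iff]
  refine ⟨fun h => ⟨fun g hg => h g (Subgroup.subset_closure (.inr hg)),
    h x (Subgroup.subset_closure (.inl rfl))⟩, fun ⟨hN, hx⟩ g hg => ?_⟩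
  induction hg using Subgroup.closure_induction with
  | mem g hg => exact hg.elim (fun h => h ▸ hx) (hN g)
  | one => simp
  | mul g h _ _ hg hh => rw [Units.val_mul, mul_assoc, hh, ← mul_assoc, hg, mul_assoc]
  | inv g _ hg =>
    rw [Units.inv_mul_eq_iff_eq_mul, ← mul_assoc, Units.eq_mul_inv_iff_mul_eq, hg]

theorem conj_mem_endAlg {m : ℕ} {N : Subgroup (GL (Fin m) ℚ)} {x : GL (Fin m) ℚ}
    (hxN : ∀ g : GL (Fin m) ℚ, g ∈ N ↔ x * g * x⁻¹ ∈ N) {q : Matrix (Fin m) (Fin m) ℚ}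
    (hq : q ∈ endAlg N) : (x : Matrix (Fin m) (Fin m) ℚ) * q * x⁻¹.val ∈ endAlg N := by
  rw [mem_endAlg_iff] at hq ⊢
  intro g hg
  have h := hq (x⁻¹ * g * x) ((hxN _).mpr (by simpa [mul_assoc] using hg))
  rw [Units.val_mul, Units.val_mul] at h
  calc (g : Matrix (Fin m) (Fin m) ℚ) * (x * q * x⁻¹.val)
      = x * (x⁻¹.val * g * x * q) * x⁻¹.val := by simp only [mul_assoc, Units.mul_inv_cancel_left]
    _ = x * q * x⁻¹.val * g := by rw [h]; simp only [mul_assoc, Units.mul_inv, mul_one]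

theorem conj_conj_of_mem_endAlg {m : ℕ} {N : Subgroup (GL (Fin m) ℚ)} {x : GL (Fin m) ℚ}
    (hx2 : x ^ 2 ∈ N) {q : Matrix (Fin m) (Fin m) ℚ} (hq : q ∈ endAlg N) :
    (x : Matrix (Fin m) (Fin m) ℚ) * (x * q * x⁻¹.val) * x⁻¹.val = q := by
  have h := mem_endAlg_iff.mp hq _ hx2
  rw [pow_two, Units.val_mul] at h
  calc (x : Matrix (Fin m) (Fin m) ℚ) * (x * q * x⁻¹.val) * x⁻¹.val
      = x * x * q * x⁻¹.val * x⁻¹.val := by simp only [mul_assoc]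
    _ = q := by rw [h]; simp only [mul_assoc, Units.mul_inv, mul_one]

/-- Conjugation by `x` as an algebra endomorphism of `End(N)` over its center, when `x` normalizes
`N` and commutes with the center of `End(N)`. -/
def endAlgConj {m : ℕ} {N : Subgroup (GL (Fin m) ℚ)} {x : GL (Fin m) ℚ}
    (hxN : ∀ g : GL (Fin m) ℚ, g ∈ N ↔ x * g * x⁻¹ ∈ N)
    (hxK : ∀ c : endAlg N, c ∈ Subring.center (endAlg N) →
      (x : Matrix (Fin m) (Fin m) ℚ) * (c : Matrix (Fin m) (Fin m) ℚ) =
        (c : Matrix (Fin m) (Fin m) ℚ) * (x : Matrix (Fin m) (Fin m) ℚ)) :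
    endAlg N →ₐ[Subring.center (endAlg N)] endAlg N where
  toFun q := ⟨x * q * x⁻¹.val, conj_mem_endAlg hxN q.2⟩
  map_one' := Subtype.ext <| by simp
  map_mul' p q := Subtype.ext <| by simp [mul_assoc]
  map_zero' := Subtype.ext <| by simp
  map_add' p q := Subtype.ext <| by simp [mul_add, add_mul]
  commutes' c := Subtype.ext <| (Units.mul_inv_eq_iff_eq_mul x).mpr (hxK c c.2)

/-- Suppose `N ≤ GL_{2n}(ℚ)` is finite and `Q := End(N)` is a quaternion algebra (a simple
ring of dimension `4` over its center `K`).  If `x ∈ GL_{2n}(ℚ)` normalizes `N`, satisfies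
`x² ∈ N`, commutes with every element of `K` but not with every element of `Q`, then there
is `a ∈ Q`, `a ∉ K`, `a² ∈ K`, with `End(⟨N, x⟩) = K[a] = {q ∈ Q : q·a = a·q}`. -/
theorem endAlg_of_normalizing_element {n : ℕ}
    (N : Subgroup (GL (Fin (2 * n)) ℚ))
    (hNfin : (N : Set (GL (Fin (2 * n)) ℚ)).Finite)
    (hsimple : IsSimpleRing (endAlg N))
    (hdim : Module.finrank (Subring.center (endAlg N)) (endAlg N) = 4)
    (x : GL (Fin (2 * n)) ℚ)
    (hxN : ∀ g : GL (Fin (2 * n)) ℚ, g ∈ N ↔ x * g * x⁻¹ ∈ N)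
    (hx2 : x ^ 2 ∈ N)
    (hxK : ∀ c : endAlg N, c ∈ Subring.center (endAlg N) →
      (x : Matrix (Fin (2 * n)) (Fin (2 * n)) ℚ) * (c : Matrix (Fin (2 * n)) (Fin (2 * n)) ℚ) =
        (c : Matrix (Fin (2 * n)) (Fin (2 * n)) ℚ) * (x : Matrix (Fin (2 * n)) (Fin (2 * n)) ℚ))
    (hxQ : ¬ ∀ q : endAlg N,
      (x : Matrix (Fin (2 * n)) (Fin (2 * n)) ℚ) * (q : Matrix (Fin (2 * n)) (Fin (2 * n)) ℚ) =
        (q : Matrix (Fin (2 * n)) (Fin (2 * n)) ℚ) * (x : Matrix (Fin (2 * n)) (Fin (2 * n)) ℚ)) :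
    ∃ a : endAlg N, a ∉ Subring.center (endAlg N) ∧ a * a ∈ Subring.center (endAlg N) ∧
      ((endAlg (Subgroup.closure (insert x (N : Set (GL (Fin (2 * n)) ℚ)))) :
          Set (Matrix (Fin (2 * n)) (Fin (2 * n)) ℚ)) =
        (fun q : endAlg N => (q : Matrix (Fin (2 * n)) (Fin (2 * n)) ℚ)) ''
          (Algebra.adjoin (Subring.center (endAlg N)) ({a} : Set (endAlg N)) :
            Set (endAlg N))) ∧
      Algebra.adjoin (Subring.center (endAlg N)) ({a} : Set (endAlg N)) =
        Subalgebra.centralizer (Subring.center (endAlg N)) ({a} : Set (endAlg N)) := by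
  let Q := endAlg N
  let τ := endAlgConj hxN hxK
  have hτ (q : Q) : τ (τ q) = q := Subtype.ext (conj_conj_of_mem_endAlg hx2 q.2)
  let σ : Q ≃ₐ[Subring.center Q] Q := .ofAlgHom τ τ (AlgHom.ext hτ) (AlgHom.ext hτ)
  have hσx (q : Q) : σ q = q ↔ (x : Matrix (Fin (2 * n)) (Fin (2 * n)) ℚ) * q = q * x :=
    Subtype.ext_iff.trans (Units.mul_inv_eq_iff_eq_mul x)
  let : Field (Subring.center Q) := (IsSimpleRing.isField_center Q).toField
  have : Algebra.IsCentral (Subring.center Q) Q :=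
    ⟨fun c hc => Algebra.mem_bot.mpr
      ⟨⟨c, Subring.mem_center_iff.mpr (Subalgebra.mem_center_iff.mp hc)⟩, rfl⟩⟩
  have h2 : (2 : Subring.center Q) ≠ 0 := by
    intro h
    have h' : ((2 : Subring.center Q) : Q) = 0 := congrArg Subtype.val h
    have : CharZero Q := algebraRat.charZero Q
    exact two_ne_zero (α := Q) h'
  obtain ⟨a, ha, haa, hfix, hadj⟩ := exists_adjoin_eq_centralizer_of_involutive h2 hdim σ hτ
    (by simpa only [hσx, ne_eq, not_forall] using hxQ)
  refine ⟨a, fun h => ha (Subalgebra.mem_center_iff.mpr (Subring.mem_center_iff.mp h)),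
    Subring.mem_center_iff.mpr (Subalgebra.mem_center_iff.mp haa), ?_, hadj⟩
  ext q
  simp only [SetLike.mem_coe, Set.mem_image, mem_endAlg_closure_insert_iff]
  constructor
  · rintro ⟨hq, hxq⟩
    exact ⟨⟨q, hq⟩, (hfix _).mp ((hσx _).mpr hxq), rfl⟩
  · rintro ⟨q, hq, rfl⟩
    exact ⟨q.2, (hσx q).mp ((hfix q).mpr hq)⟩
end
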